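/- arXiv:2207.13650 — 3 statements merged into one kernel-verified Lean document; each statement's English description precedes it below -/
import Mathlib

section
/- Let G be a 2-connected graph with circumference c(G) ≤ 2k + 1, and let P = x_1 x_2 … x_m be a longest path in G with m ≥ 2k + 2 vertices such that d_G(x_1) ≥ k and d_G(x_m) ≥ k. Let g = max{w : x_w is a neighbor of x_1} and h = min{w : x_w is a neighbor of x_m}. Then g ≥ h. -/
open SimpleGraph

/-- `G` is (isomorphic to) a subgraph of `H`: there is an injective map preserving adjacency. -/
def IsSubgraphOf {α β : Type*} (G : SimpleGraph α) (H : SimpleGraph β) : Prop :=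
  ∃ f : α ↪ β, ∀ ⦃a b : α⦄, G.Adj a b → H.Adj (f a) (f b)

/-- A graph is 2-connected if it has at least 3 vertices and deleting any single
vertex leaves it connected. -/
def TwoConnected {α : Type*} (G : SimpleGraph α) : Prop :=
  3 ≤ Nat.card α ∧ ∀ v : α, (G.induce {u : α | u ≠ v}).Connected

/-- The circumference of a graph: the length of a longest cycle (0 if there is none). -/
noncomputable def circumference {α : Type*} (G : SimpleGraph α) : ℕ :=
  sSup {n : ℕ | ∃ (v : α) (w : G.Walk v v), w.IsCycle ∧ w.length = n}

/-- The degree of a vertex (as the cardinality of its neighborhood). -/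
noncomputable def gdeg {α : Type*} (G : SimpleGraph α) (v : α) : ℕ :=
  (G.neighborSet v).ncard

/-- The join `G + H` of two graphs. -/
def graphJoin {α β : Type*} (G : SimpleGraph α) (H : SimpleGraph β) :
    SimpleGraph (α ⊕ β) :=
  SimpleGraph.fromRel fun x y =>
    match x, y with
    | Sum.inl a, Sum.inl b => G.Adj a b
    | Sum.inr a, Sum.inr b => H.Adj a b
    | _, _ => True

/-- The disjoint union `G ∪ H` of two graphs. -/
def graphUnion {α β : Type*} (G : SimpleGraph α) (H : SimpleGraph β) :
    SimpleGraph (α ⊕ β) :=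
  SimpleGraph.fromRel fun x y =>
    match x, y with
    | Sum.inl a, Sum.inl b => G.Adj a b
    | Sum.inr a, Sum.inr b => H.Adj a b
    | _, _ => False

/-- `cliques t m` is `t` vertex-disjoint copies of the complete graph `K_m`. -/
def cliques (t m : ℕ) : SimpleGraph (Fin t × Fin m) :=
  SimpleGraph.fromRel fun x y => x.1 = y.1

/-- The graph `H(n, l, a)` on vertex partition `A ∪ B ∪ C` with `|A| = a`,
`|B| = n - l + a`, `|C| = l - 2a`, joining all pairs between `A` and `B` and
all pairs inside `A ∪ C`.  Here `A` consists of the indices `< a`, `B` of the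
indices in `[a, n - l + 2a)` and `C` of the remaining indices. -/
def Hgraph (n l a : ℕ) : SimpleGraph (Fin n) :=
  SimpleGraph.fromRel fun i j =>
    ((i : ℕ) < a ∧ a ≤ (j : ℕ) ∧ (j : ℕ) < n - l + 2 * a) ∨
    (((i : ℕ) < a ∨ n - l + 2 * a ≤ (i : ℕ)) ∧ ((j : ℕ) < a ∨ n - l + 2 * a ≤ (j : ℕ)))

/-- `M_t`: a matching with `⌊t/2⌋` edges on `t` vertices (plus an isolated vertex if `t` is odd). -/
def matchingGraph (t : ℕ) : SimpleGraph (Fin t) :=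
  SimpleGraph.fromRel fun i j => (j : ℕ) = (i : ℕ) + 1 ∧ (i : ℕ) % 2 = 0

/-- `S_s = K_{1, s-1}`: the star on `s` vertices, with center `0`. -/
def starGraph (s : ℕ) : SimpleGraph (Fin s) :=
  SimpleGraph.fromRel fun i _ => (i : ℕ) = 0

/-- `F(s, t, k)`: obtained from the disjoint graphs `K_3` (with vertices `x = 0`, `y = 1`,
`z = 2`), `sK_{k-1} ∪ K_1` and `tK_{k-1}`, joining `x` and `z` to every vertex of
`sK_{k-1} ∪ K_1` and joining `y` and `z` to every vertex of `tK_{k-1}`. -/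
def Fgraph (s t k : ℕ) :
    SimpleGraph (Fin 3 ⊕ (((Fin s × Fin (k - 1)) ⊕ Fin 1) ⊕ (Fin t × Fin (k - 1)))) :=
  SimpleGraph.fromRel fun x y =>
    match x, y with
    | Sum.inl _, Sum.inl _ => True
    | Sum.inl i, Sum.inr (Sum.inl _) => i = 0 ∨ i = 2
    | Sum.inl i, Sum.inr (Sum.inr _) => i = 1 ∨ i = 2
    | Sum.inr (Sum.inl (Sum.inl a)), Sum.inr (Sum.inl (Sum.inl b)) => a.1 = b.1
    | Sum.inr (Sum.inr a), Sum.inr (Sum.inr b) => a.1 = b.1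
    | _, _ => False

/-- `F_1(t, k) = K_2 + (tK_{k-1} ∪ K_k ∪ K_1)`. -/
def F1graph (t k : ℕ) :
    SimpleGraph (Fin 2 ⊕ ((Fin t × Fin (k - 1)) ⊕ (Fin k ⊕ Fin 1))) :=
  graphJoin (⊤ : SimpleGraph (Fin 2))
    (graphUnion (cliques t (k - 1))
      (graphUnion (⊤ : SimpleGraph (Fin k)) (⊤ : SimpleGraph (Fin 1))))

/-- The graph obtained from the cones `K_1 + G` and `K_1 + H` by joining the two apexes. -/
def joinCenters {α β : Type*} (G : SimpleGraph α) (H : SimpleGraph β) :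
    SimpleGraph ((Fin 1 ⊕ α) ⊕ (Fin 1 ⊕ β)) :=
  SimpleGraph.fromRel fun x y =>
    match x, y with
    | Sum.inl a, Sum.inl b => (graphJoin (⊤ : SimpleGraph (Fin 1)) G).Adj a b
    | Sum.inr a, Sum.inr b => (graphJoin (⊤ : SimpleGraph (Fin 1)) H).Adj a b
    | Sum.inl (Sum.inl _), Sum.inr (Sum.inl _) => True
    | _, _ => False

/-- `v` is a cut vertex of `G`: two other vertices are connected in `G` but not in `G - v`. -/
def IsCutVertex {α : Type*} (G : SimpleGraph α) (v : α) : Prop :=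
  ∃ a b : ↥{u : α | u ≠ v}, G.Reachable a.1 b.1 ∧
    ¬ (G.induce {u : α | u ≠ v}).Reachable a b

/-- `G.induce S` is an end block of `G`: a maximal 2-connected (induced) subgraph
containing at most one cut vertex of `G`. -/
def IsEndBlockOn {α : Type*} (G : SimpleGraph α) (S : Set α) : Prop :=
  TwoConnected (G.induce S) ∧
  (∀ T : Set α, S ⊆ T → TwoConnected (G.induce T) → T = S) ∧
  {v ∈ S | IsCutVertex G v}.Subsingleton

theorem circumference_ge {V : Type*} [Fintype V] {G : SimpleGraph V} {v : V} {w : G.Walk v v}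
    (hw : w.IsCycle) : w.length ≤ circumference G := by
  refine le_csSup ⟨Fintype.card V, ?_⟩ ⟨v, w, hw, rfl⟩
  rintro _ ⟨u, c, hc, rfl⟩
  have h := hc.support_nodup.length_le_card
  simpa using h

/-- Two paths that meet only in one common endpoint concatenate to a path. -/
theorem SimpleGraph.Walk.IsPath.append_of_inter {V : Type*} {G : SimpleGraph V} {u v w : V}
    {p : G.Walk u v} {q : G.Walk v w} (hp : p.IsPath) (hq : q.IsPath)
    (h : ∀ z, z ∈ p.support → z ∈ q.support → z = v) : (p.append q).IsPath := by
  rw [Walk.isPath_def, Walk.support_append, List.nodup_append']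
  refine ⟨hp.support_nodup, hq.support_nodup.tail, ?_⟩
  intro z hz hz'
  have h1 := h z hz (List.mem_of_mem_tail hz')
  subst h1
  have h2 := hq.support_nodup
  rw [← Walk.cons_tail_support] at h2
  exact (List.nodup_cons.1 h2).1 hz'

theorem SimpleGraph.Walk.ncard_le_of_subset_support {V : Type*} {G : SimpleGraph V}
    {u v : V} {p : G.Walk u v} {s : Set V} (hs : ∀ z ∈ s, z ∈ p.support) :
    s.ncard ≤ p.length + 1 := by
  classical
  have h1 : s ⊆ (p.support.toFinset : Set V) := fun z hz => by simpa using hs z hz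
  calc s.ncard ≤ (p.support.toFinset : Set V).ncard := Set.ncard_le_ncard h1 (Finset.finite_toSet _)
    _ = p.support.toFinset.card := Set.ncard_coe_finset _
    _ ≤ p.support.length := List.toFinset_card_le _
    _ = p.length + 1 := by simp

theorem SimpleGraph.exists_isPath_of_connected_induce {V : Type*} {G : SimpleGraph V} {s : Set V}
    (hs : (G.induce s).Connected) {u v : V} (hu : u ∈ s) (hv : v ∈ s) :
    ∃ p : G.Walk u v, p.IsPath ∧ ∀ z ∈ p.support, z ∈ s := by
  obtain ⟨q, hq⟩ := hs.exists_isPath ⟨u, hu⟩ ⟨v, hv⟩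
  refine ⟨q.map (Embedding.induce s).toHom, hq.map Subtype.val_injective, ?_⟩
  intro z hz
  have hz' : z ∈ (q.map (Embedding.induce s).toHom).support := hz
  rw [Walk.support_map, List.mem_map] at hz'
  obtain ⟨y, -, rfl⟩ := hz'
  exact y.2

/-- A walk from `Z` to `T` contains a subwalk leaving `Z` for good and stopping just before it
reaches `T`. -/
theorem SimpleGraph.Walk.exists_connected_bridge {V : Type*} {G : SimpleGraph V} {u w : V}
    (p : G.Walk u w) (Z T : Set V) (hu : u ∈ Z) (huT : u ∉ T) (hw : w ∈ T) :
    ∃ z ∈ Z, ∃ t ∈ T, ∃ Q : Set V, (G.induce Q).Connected ∧ z ∈ Q ∧ (∃ q ∈ Q, G.Adj q t) ∧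
      (∀ v ∈ Q, v ∈ p.support) ∧ (∀ v ∈ Q, v ∈ Z → v = z) ∧ ∀ v ∈ Q, v ∉ T := by
  induction p generalizing Z with
  | nil => exact absurd hw huT
  | @cons u u' w hadj p ih =>
    by_cases h1 : u' ∈ T
    · refine ⟨u, hu, u', h1, {u}, ?_, rfl, ⟨u, rfl, hadj⟩, by simp, by simp, by simpa using huT⟩
      exact Connected.of_subsingleton
    · obtain ⟨z, hz, t, ht, Q, hQ, hzQ, hq, hsup, hZ, hT⟩ := ih (insert u' Z) (by simp) h1 hw
      by_cases h2 : z = u' ∧ u' ∉ Z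
      · obtain ⟨rfl, h2⟩ := h2
        refine ⟨u, hu, t, ht, {u} ∪ Q, ?_, by simp, ?_, ?_, ?_, ?_⟩
        · exact connected_induce_union (Connected.of_subsingleton).preconnected hQ.preconnected
            (Set.mem_singleton u) hzQ hadj
        · obtain ⟨q, hq, hqt⟩ := hq
          exact ⟨q, Or.inr hq, hqt⟩
        · rintro v (rfl | hv)
          · simp
          · simp [hsup v hv]
        · rintro v (rfl | hv) hvZ
          · rfl
          · have := hZ v hv (Or.inr hvZ)
            exact absurd (this ▸ hvZ) h2
        · rintro v (rfl | hv)
          · exact huT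
          · exact hT v hv
      · have hz' : z ∈ Z := by
          rcases hz with rfl | hz
          · by_contra h; exact h2 ⟨rfl, h⟩
          · exact hz
        exact ⟨z, hz', t, ht, Q, hQ, hzQ, hq, fun v hv => by simp [hsup v hv],
          fun v hv hvZ => hZ v hv (Or.inr hvZ), hT⟩

/-- `f 0, …, f n` are the successive vertices of a path in `G`. -/
structure IsVertexPath {V : Type*} (G : SimpleGraph V) (f : ℕ → V) (n : ℕ) : Prop where
  adj : ∀ i < n, G.Adj (f i) (f (i + 1))
  inj : ∀ i ≤ n, ∀ j ≤ n, f i = f j → i = j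

namespace IsVertexPath

variable {V : Type*} {G : SimpleGraph V} {f : ℕ → V} {n : ℕ}

theorem reverse (hf : IsVertexPath G f n) : IsVertexPath G (fun i => f (n - i)) n where
  adj i hi := by
    have h := (hf.adj (n - (i + 1)) (by omega)).symm
    rwa [show n - (i + 1) + 1 = n - i by omega] at h
  inj i hi j hj h := by
    have := hf.inj (n - i) (by omega) (n - j) (by omega) h
    omega

theorem exists_isPath (hf : IsVertexPath G f n) {a b : ℕ} (hab : a ≤ b) (hb : b ≤ n) :
    ∃ p : G.Walk (f a) (f b), p.IsPath ∧ ∀ v, v ∈ p.support ↔ v ∈ f '' Set.Icc a b := by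
  induction b, hab using Nat.le_induction with
  | base => exact ⟨Walk.nil, by simp, by simp⟩
  | succ b hab ih =>
    obtain ⟨p, hp, hs⟩ := ih (by omega)
    refine ⟨p.concat (hf.adj b (by omega)), hp.concat ?_ _, ?_⟩
    · rw [hs]
      rintro ⟨i, ⟨-, hi⟩, h⟩
      have := hf.inj i (by omega) (b + 1) hb h
      omega
    · intro v
      rw [Walk.support_concat, List.mem_append, hs, List.mem_singleton]
      constructor
      · rintro (⟨i, ⟨h1, h2⟩, rfl⟩ | rfl)
        · exact ⟨i, ⟨h1, by omega⟩, rfl⟩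
        · exact ⟨b + 1, ⟨by omega, le_rfl⟩, rfl⟩
      · rintro ⟨i, ⟨h1, h2⟩, rfl⟩
        rcases Nat.lt_or_ge b i with h | h
        · right; congr 1; omega
        · exact Or.inl ⟨i, ⟨h1, h⟩, rfl⟩

theorem connected_induce (hf : IsVertexPath G f n) {a b : ℕ} (hab : a ≤ b) (hb : b ≤ n) :
    (G.induce (f '' Set.Icc a b)).Connected := by
  obtain ⟨p, -, hs⟩ := hf.exists_isPath hab hb
  have h := p.connected_induce_support
  rwa [show {v | v ∈ p.support} = f '' Set.Icc a b from Set.ext hs] at h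

/-- If `f g` is the last neighbor of `f 0`, then for `a < g` the segment up to `f g` can be
rerouted into a path from `f a` to `f g` through `f 0` and all its neighbors. -/
theorem exists_isPath_through_neighbors (hf : IsVertexPath G f n) {a g : ℕ} (hag : a < g)
    (hg : g ≤ n) (hadj : G.Adj (f 0) (f g))
    (hnbr : ∀ v, G.Adj (f 0) v → ∃ w ≤ g, f w = v) :
    ∃ p : G.Walk (f a) (f g), p.IsPath ∧ (∀ v ∈ p.support, v ∈ f '' Set.Icc 0 g) ∧
      f 0 ∈ p.support ∧ ∀ v, G.Adj (f 0) v → v ∈ p.support := by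
  classical
  have hex : ∃ b, a < b ∧ G.Adj (f 0) (f b) := ⟨g, hag, hadj⟩
  obtain ⟨hab, hb⟩ := Nat.find_spec hex
  have hmin : ∀ w, w < Nat.find hex → ¬ (a < w ∧ G.Adj (f 0) (f w)) := fun w => Nat.find_min hex
  have hbg : Nat.find hex ≤ g := Nat.find_min' hex ⟨hag, hadj⟩
  generalize Nat.find hex = b at hab hb hmin hbg
  obtain ⟨p, hp, hps⟩ := hf.exists_isPath (Nat.zero_le a) (by omega)
  obtain ⟨q, hq, hqs⟩ := hf.exists_isPath hbg hg
  have hdisj : ∀ z, z ∈ f '' Set.Icc 0 a → z ∉ f '' Set.Icc b g := by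
    rintro _ ⟨i, ⟨-, hi⟩, rfl⟩ ⟨j, ⟨hj, hj'⟩, h⟩
    have := hf.inj j (by omega) i (by omega) h
    omega
  have h0 : f 0 ∈ f '' Set.Icc 0 a := ⟨0, by simp, rfl⟩
  have hmem : ∀ v, v ∈ (p.reverse.append (Walk.cons hb q)).support ↔
      v ∈ f '' Set.Icc 0 a ∨ v ∈ f '' Set.Icc b g := by
    intro v
    rw [Walk.mem_support_append_iff, Walk.support_reverse, List.mem_reverse, hps,
      Walk.support_cons, List.mem_cons, hqs]
    constructor
    · rintro (h | rfl | h)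
      exacts [Or.inl h, Or.inl h0, Or.inr h]
    · rintro (h | h)
      exacts [Or.inl h, Or.inr (Or.inr h)]
  refine ⟨p.reverse.append (Walk.cons hb q), ?_, ?_, ?_, ?_⟩
  · refine hp.reverse.append_of_inter (hq.cons ?_) ?_
    · rw [hqs]; exact hdisj _ h0
    · intro z hz hz'
      rw [Walk.support_reverse, List.mem_reverse, hps] at hz
      rw [Walk.support_cons, List.mem_cons, hqs] at hz'
      exact hz'.resolve_right (hdisj z hz)
  · intro v hv
    rcases (hmem v).1 hv with ⟨i, ⟨h1, h2⟩, rfl⟩ | ⟨i, ⟨h1, h2⟩, rfl⟩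
    · exact ⟨i, ⟨h1, by omega⟩, rfl⟩
    · exact ⟨i, ⟨by omega, h2⟩, rfl⟩
  · exact (hmem _).2 (Or.inl h0)
  · intro v hv
    obtain ⟨w, hw, rfl⟩ := hnbr v hv
    refine (hmem _).2 ?_
    by_cases hwa : w ≤ a
    · exact Or.inl ⟨w, ⟨by omega, hwa⟩, rfl⟩
    · refine Or.inr ⟨w, ⟨?_, hw⟩, rfl⟩
      by_contra hlt
      exact hmin w (by omega) ⟨by omega, hv⟩

/-- In a 2-connected graph, any set `Z` containing the path in front of `f j` is connected
past `f j` to a later vertex of the path. -/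
theorem exists_bridge (hf : IsVertexPath G f n) (h2c : TwoConnected G) {j : ℕ} (hj : 0 < j)
    (hjn : j < n) (Z : Set V) (hZ : ∀ w < j, f w ∈ Z) :
    ∃ j', j < j' ∧ j' ≤ n ∧ ∃ z ∈ Z, ∃ Q : Set V, (G.induce Q).Connected ∧ z ∈ Q ∧
      (∃ q ∈ Q, G.Adj q (f j')) ∧ (∀ v ∈ Q, v ∈ Z → v = z) ∧ ∀ w ≤ n, j ≤ w → f w ∉ Q := by
  have hne : ∀ w ≤ n, w ≠ j → f w ∈ {u : V | u ≠ f j} := fun w hw h h' =>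
    h (hf.inj w hw j hjn.le h')
  obtain ⟨p, -, hp⟩ := exists_isPath_of_connected_induce (h2c.2 (f j))
    (hne 0 (by omega) (by omega)) (hne n le_rfl (by omega))
  obtain ⟨z, hz, t, ⟨j', ⟨hjj, hjn'⟩, rfl⟩, Q, hQ, hzQ, hq, hsup, hQZ, hQT⟩ :=
    p.exists_connected_bridge Z (f '' Set.Icc (j + 1) n) (hZ 0 hj)
      (by
        rintro ⟨i, ⟨h1, h2⟩, h⟩
        have := hf.inj i h2 0 (by omega) h
        omega)
      ⟨n, ⟨hjn, le_rfl⟩, rfl⟩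
  refine ⟨j', hjj, hjn', z, hz, Q, hQ, hzQ, hq, hQZ, fun w hw hjw hwQ => ?_⟩
  rcases hjw.eq_or_lt with rfl | h
  · exact hp _ (hsup _ hwQ) rfl
  · exact hQT _ hwQ ⟨w, ⟨h, hw⟩, rfl⟩

end IsVertexPath

/-- Two disjoint connected sets, one containing `f g` and the other some `f a` with `a < g`, such
that one of them contains `f i` and the other is adjacent to `f j`; apart from `f a` they meet
the path exactly in the segment from `f g` to `f i`. -/
def IsLinked {V : Type*} (G : SimpleGraph V) (f : ℕ → V) (n g i j : ℕ) : Prop :=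
  ∃ a, a < g ∧ ∃ s₁ s₂ : V, ((s₁ = f a ∧ s₂ = f g) ∨ (s₁ = f g ∧ s₂ = f a)) ∧
    ∃ S₁ S₂ : Set V, s₁ ∈ S₁ ∧ s₂ ∈ S₂ ∧ (G.induce S₁).Connected ∧ (G.induce S₂).Connected ∧
      (∀ v ∈ S₁, v ∉ S₂) ∧ f i ∈ S₁ ∧ (∃ u ∈ S₂, G.Adj u (f j)) ∧
      ∀ w ≤ n, f w ∈ S₁ ∪ S₂ ↔ w = a ∨ (g ≤ w ∧ w ≤ i)

namespace IsVertexPath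

variable {V : Type*} {G : SimpleGraph V} {f : ℕ → V} {n : ℕ}

theorem isLinked_of_bridge (hf : IsVertexPath G f n) {g i j j' t : ℕ} (ht : t < g) (hgj : g ≤ j)
    (hji : j ≤ i) (hin : i ≤ n) {Q : Set V} (hQ : (G.induce Q).Connected) (htQ : f t ∈ Q)
    (hq : ∃ q ∈ Q, G.Adj q (f j')) (hQt : ∀ w < j, f w ∈ Q → f w = f t)
    (hQj : ∀ w ≤ n, j ≤ w → f w ∉ Q) : IsLinked G f n g i j' := by
  have hQP : ∀ w ≤ n, f w ∈ Q → w = t := fun w hw h => by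
    by_cases hwj : w < j
    · exact hf.inj w hw t (by omega) (hQt w hwj h)
    · exact absurd h (hQj w hw (by omega))
  refine ⟨t, ht, f g, f t, Or.inr ⟨rfl, rfl⟩, f '' Set.Icc g i, Q, ⟨g, ⟨le_rfl, by omega⟩, rfl⟩,
    htQ, hf.connected_induce (by omega) hin, hQ, ?_, ⟨i, ⟨by omega, le_rfl⟩, rfl⟩, hq, ?_⟩
  · rintro _ ⟨w, ⟨h1, h2⟩, rfl⟩ h
    have := hQP w (by omega) h
    omega
  · intro w hw
    constructor
    · rintro (⟨v, ⟨h1, h2⟩, h⟩ | h)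
      · have := hf.inj v (by omega) w hw h
        omega
      · exact Or.inl (hQP w hw h)
    · rintro (rfl | h)
      · exact Or.inr htQ
      · exact Or.inl ⟨w, h, rfl⟩

theorem isLinked_start (hf : IsVertexPath G f n) (h2c : TwoConnected G) {g : ℕ} (hg : 0 < g)
    (hgn : g < n) : ∃ j', g < j' ∧ j' ≤ n ∧ ∀ i, g ≤ i → i < j' → IsLinked G f n g i j' := by
  obtain ⟨j', hj, hjn, z, ⟨t, ht, rfl⟩, Q, hQ, htQ, hq, hQZ, hQj⟩ :=
    hf.exists_bridge h2c hg hgn (f '' Set.Iio g) (fun w hw => ⟨w, hw, rfl⟩)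
  exact ⟨j', hj, hjn, fun i hi hij => hf.isLinked_of_bridge ht le_rfl hi (by omega) hQ htQ hq
    (fun w hw h => hQZ _ h ⟨w, hw, rfl⟩) hQj⟩

theorem isLinked_step (hf : IsVertexPath G f n) (h2c : TwoConnected G) {g j : ℕ} (hgj : g ≤ j)
    (hjn : j + 1 < n) (hL : IsLinked G f n g j (j + 1)) :
    ∃ j', j + 1 < j' ∧ j' ≤ n ∧ ∀ i, j + 1 ≤ i → i < j' → IsLinked G f n g i j' := by
  obtain ⟨a, ha, s₁, s₂, hs, S₁, S₂, hs₁, hs₂, hS₁, hS₂, hdisj, hj₁, ⟨u, hu, huj⟩, hP⟩ := hL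
  obtain ⟨j', hj, hjn', z, hz, Q, hQ, hzQ, ⟨q, hqQ, hq⟩, hQZ, hQj⟩ :=
    hf.exists_bridge h2c (Nat.succ_pos j) hjn (f '' Set.Iio (j + 1) ∪ (S₁ ∪ S₂))
      (fun w hw => Or.inl ⟨w, hw, rfl⟩)
  refine ⟨j', hj, hjn', fun i hi hij => ?_⟩
  have hseg : (G.induce (f '' Set.Icc (j + 1) i)).Connected :=
    hf.connected_induce hi (by omega)
  have hsegS : ∀ v ∈ f '' Set.Icc (j + 1) i, v ∉ S₁ ∪ S₂ := by
    rintro _ ⟨w, ⟨h1, h2⟩, rfl⟩ h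
    have := (hP w (by omega)).1 h
    omega
  have hsegQ : ∀ v ∈ f '' Set.Icc (j + 1) i, v ∉ Q := by
    rintro _ ⟨w, ⟨h1, h2⟩, rfl⟩
    exact hQj w (by omega) h1
  have hstart : f (j + 1) ∈ f '' Set.Icc (j + 1) i := ⟨j + 1, ⟨le_rfl, hi⟩, rfl⟩
  have hend : f i ∈ f '' Set.Icc (j + 1) i := ⟨i, ⟨hi, le_rfl⟩, rfl⟩
  have hzj : ∀ w ≤ n, f w ∈ Q → f w = z := fun w hw h => by
    by_cases hwj : w < j + 1
    · exact hQZ _ h (Or.inl ⟨w, hwj, rfl⟩)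
    · exact absurd h (hQj w hw (by omega))
  have hcover : z ∈ S₁ ∪ S₂ → ∀ w ≤ n,
      (f w ∈ S₁ ∨ f w ∈ S₂ ∨ f w ∈ f '' Set.Icc (j + 1) i ∨ f w ∈ Q) ↔
        w = a ∨ (g ≤ w ∧ w ≤ i) := by
    intro hzS w hw
    have hPw := hP w hw
    constructor
    · rintro (h | h | ⟨v, ⟨h1, h2⟩, h⟩ | h)
      · have := hPw.1 (Or.inl h)
        omega
      · have := hPw.1 (Or.inr h)
        omega
      · have := hf.inj v (by omega) w hw h
        omega
      · rw [← hzj w hw h] at hzS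
        have := hPw.1 hzS
        omega
    · intro h
      by_cases hwj : w ≤ j
      · rcases hPw.2 (by omega) with h | h
        exacts [Or.inl h, Or.inr (Or.inl h)]
      · exact Or.inr (Or.inr (Or.inl ⟨w, by constructor <;> omega, rfl⟩))
  by_cases hz₁ : z ∈ S₁
  · refine ⟨a, ha, s₂, s₁, hs.symm.imp And.symm And.symm, S₂ ∪ f '' Set.Icc (j + 1) i, S₁ ∪ Q,
      Or.inl hs₂, Or.inl hs₁,
      connected_induce_union hS₂.preconnected hseg.preconnected hu hstart huj,
      induce_union_connected hS₁.preconnected hQ.preconnected ⟨z, hz₁, hzQ⟩, ?_, Or.inr hend,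
      ⟨q, Or.inr hqQ, hq⟩, ?_⟩
    · rintro v (h | h) (h' | h')
      · exact hdisj v h' h
      · have := hQZ v h' (Or.inr (Or.inr h))
        exact hdisj v (this ▸ hz₁) h
      · exact hsegS v h (Or.inl h')
      · exact hsegQ v h h'
    · intro w hw
      rw [← hcover (Or.inl hz₁) w hw]
      simp only [Set.mem_union]
      tauto
  by_cases hz₂ : z ∈ S₂
  · refine ⟨a, ha, s₁, s₂, hs, S₁ ∪ f '' Set.Icc (j + 1) i, S₂ ∪ Q,
      Or.inl hs₁, Or.inl hs₂,
      connected_induce_union hS₁.preconnected hseg.preconnected hj₁ hstart (hf.adj j (by omega)),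
      induce_union_connected hS₂.preconnected hQ.preconnected ⟨z, hz₂, hzQ⟩, ?_, Or.inr hend,
      ⟨q, Or.inr hqQ, hq⟩, ?_⟩
    · rintro v (h | h) (h' | h')
      · exact hdisj v h h'
      · have := hQZ v h' (Or.inr (Or.inl h))
        exact hdisj v h (this ▸ hz₂)
      · exact hsegS v h (Or.inr h')
      · exact hsegQ v h h'
    · intro w hw
      rw [← hcover (Or.inr hz₂) w hw]
      simp only [Set.mem_union]
      tauto
  · obtain ⟨t, ht, rfl⟩ := hz.resolve_right (by rintro (h | h); exacts [hz₁ h, hz₂ h])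
    have ht' : t < j + 1 := ht
    have htg : t < g := by
      by_contra h
      rcases (hP t (by omega)).2 (by omega) with h | h
      exacts [hz₁ h, hz₂ h]
    exact hf.isLinked_of_bridge htg (by omega) hi (by omega) hQ hzQ ⟨q, hqQ, hq⟩
      (fun w hw h => hzj w (by omega) h) hQj

theorem exists_isLinked (hf : IsVertexPath G f n) (h2c : TwoConnected G) {g h : ℕ} (hg : 0 < g)
    (hgh : g < h) (hhn : h < n) : ∃ j, h < j ∧ j ≤ n ∧ IsLinked G f n g h j := by
  have key : ∀ d j, h - j = d → g ≤ j → j < n → IsLinked G f n g j (j + 1) →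
      (h ≤ j → IsLinked G f n g h (j + 1)) → ∃ j, h < j ∧ j ≤ n ∧ IsLinked G f n g h j := by
    intro d
    induction d using Nat.strong_induction_on with
    | _ d ih =>
      intro j hd hgj hjn hL hLh
      by_cases hj : h ≤ j
      · exact ⟨j + 1, by omega, by omega, hLh hj⟩
      · obtain ⟨j', hjj, hjn', hstep⟩ := hf.isLinked_step h2c hgj (by omega) hL
        obtain ⟨i, rfl⟩ : ∃ i, j' = i + 1 := ⟨j' - 1, by omega⟩
        exact ih _ (by omega) i rfl (by omega) (by omega) (hstep i (by omega) (by omega))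
          fun hi => hstep h (by omega) (by omega)
  obtain ⟨j', hj, hjn, hstart⟩ := hf.isLinked_start h2c hg (by omega)
  obtain ⟨i, rfl⟩ : ∃ i, j' = i + 1 := ⟨j' - 1, by omega⟩
  exact key _ i rfl (by omega) (by omega) (hstart i (by omega) (by omega))
    fun hi => hstart h (by omega) (by omega)

/-- If the last neighbor `f g` of `f 0` precedes the first neighbor `f h` of `f n`, then some
cycle is longer than the sum of the degrees of the two ends by at least two. -/
theorem exists_isCycle (hf : IsVertexPath G f n) (h2c : TwoConnected G) {g h : ℕ} (hg : 0 < g)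
    (hgh : g < h) (hhn : h < n) (hadj₀ : G.Adj (f 0) (f g))
    (hnbr₀ : ∀ v, G.Adj (f 0) v → ∃ w ≤ g, f w = v) (hadj₁ : G.Adj (f n) (f h))
    (hnbr₁ : ∀ v, G.Adj (f n) v → ∃ w, h ≤ w ∧ w ≤ n ∧ f w = v) [Finite V] :
    ∃ (v : V) (c : G.Walk v v), c.IsCycle ∧
      (G.neighborSet (f 0)).ncard + (G.neighborSet (f n)).ncard + 2 ≤ c.length := by
  obtain ⟨j, hhj, hjn, a, ha, s₁, s₂, hs, S₁, S₂, hs₁, hs₂, hS₁, hS₂, hdisj, hi₁, ⟨u, hu, huj⟩,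
    hP⟩ := hf.exists_isLinked h2c hg hgh hhn
  have hjS : f j ∉ S₁ ∪ S₂ := fun h' => by
    have := (hP j hjn).1 h'
    omega
  have hnc : ∀ (x : V) {s t : V} (q : G.Walk s t), x ∈ q.support →
      (∀ v, G.Adj x v → v ∈ q.support) → (G.neighborSet x).ncard ≤ q.length := by
    intro x s t q hx hq
    have h1 : (insert x (G.neighborSet x)).ncard ≤ q.length + 1 := by
      refine Walk.ncard_le_of_subset_support (p := q) ?_
      rintro z (rfl | hz)
      exacts [hx, hq z hz]
    rw [Set.ncard_insert_of_notMem (by simp) (Set.toFinite _)] at h1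
    omega
  obtain ⟨A, hA, hAs, hAn⟩ : ∃ A : G.Walk s₂ s₁, A.IsPath ∧
      (∀ v ∈ A.support, v ∈ f '' Set.Icc 0 g) ∧ (G.neighborSet (f 0)).ncard ≤ A.length := by
    obtain ⟨A, hA, hAs, hA0, hAn⟩ :=
      hf.exists_isPath_through_neighbors ha (by omega) hadj₀ hnbr₀
    rcases hs with ⟨rfl, rfl⟩ | ⟨rfl, rfl⟩
    · exact ⟨A.reverse, hA.reverse, by simpa using hAs, by simpa using hnc _ A hA0 hAn⟩
    · exact ⟨A, hA, hAs, hnc _ A hA0 hAn⟩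
  obtain ⟨B, hB, hBs, hBn⟩ : ∃ B : G.Walk (f h) (f j), B.IsPath ∧
      (∀ v ∈ B.support, v ∈ f '' Set.Icc h n) ∧ (G.neighborSet (f n)).ncard ≤ B.length := by
    obtain ⟨B, hB, hBs, hB0, hBn⟩ :=
      hf.reverse.exists_isPath_through_neighbors (a := n - j) (g := n - h) (by omega) (by omega)
        (by rwa [Nat.sub_zero, Nat.sub_sub_self hhn.le])
        (by
          intro v hv
          obtain ⟨w, h1, h2, rfl⟩ := hnbr₁ v hv
          exact ⟨n - w, by omega, by rw [Nat.sub_sub_self h2]⟩)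
    have h1 : n - (n - j) = j := by omega
    have h2 : n - (n - h) = h := by omega
    refine ⟨(B.copy (congrArg f h1) (congrArg f h2)).reverse, by simpa using hB, ?_,
      by simpa using hnc _ B hB0 hBn⟩
    intro v hv
    obtain ⟨i, ⟨-, hi⟩, rfl⟩ := hBs v (by simpa using hv)
    exact ⟨n - i, ⟨by omega, by omega⟩, rfl⟩
  obtain ⟨R₁, hR₁, hR₁s⟩ := exists_isPath_of_connected_induce hS₁ hs₁ hi₁
  obtain ⟨R₂, hR₂, hR₂s⟩ := exists_isPath_of_connected_induce hS₂ hu hs₂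
  have hAP : ∀ v ∈ A.support, v ∈ S₁ ∪ S₂ → v = s₁ ∨ v = s₂ := by
    intro v hv hvS
    obtain ⟨w, ⟨-, hw⟩, rfl⟩ := hAs v hv
    have h1 : w = a ∨ w = g := by
      have := (hP w (by omega)).1 hvS
      omega
    rcases h1 with rfl | rfl <;> rcases hs with ⟨h1, h2⟩ | ⟨h1, h2⟩ <;> simp [h1, h2]
  have hBP : ∀ v ∈ B.support, v ∈ S₁ ∪ S₂ → v = f h := by
    intro v hv hvS
    obtain ⟨w, ⟨hw, hw'⟩, rfl⟩ := hBs v hv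
    have := (hP w hw').1 hvS
    congr 1
    omega
  have hAB : ∀ v ∈ A.support, v ∉ B.support := by
    intro v hv hv'
    obtain ⟨w, ⟨-, hw⟩, rfl⟩ := hAs v hv
    obtain ⟨w', ⟨hw', hwn⟩, hww⟩ := hBs _ hv'
    have := hf.inj w' hwn w (by omega) hww
    omega
  have hjR₂ : f j ∉ R₂.support := fun h' => hjS (Or.inr (hR₂s _ h'))
  have hC : (Walk.cons huj.symm R₂).IsPath := hR₂.cons hjR₂
  have hBC : (B.append (Walk.cons huj.symm R₂)).IsPath := by
    refine hB.append_of_inter hC ?_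
    intro z hz hz'
    rcases List.mem_cons.1 hz' with rfl | hz'
    · rfl
    · have h1 := hR₂s z hz'
      have h2 := hBP z hz (Or.inr h1)
      exact absurd h1 (hdisj z (h2 ▸ hi₁))
  have hRBC : (R₁.append (B.append (Walk.cons huj.symm R₂))).IsPath := by
    refine hR₁.append_of_inter hBC ?_
    intro z hz hz'
    have h1 := hR₁s z hz
    rcases (Walk.mem_support_append_iff _ _).1 hz' with hz' | hz'
    · exact hBP z hz' (Or.inl h1)
    · rcases List.mem_cons.1 hz' with rfl | hz'
      · exact absurd (Or.inl h1) hjS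
      · exact absurd (hR₂s z hz') (hdisj z h1)
  have hR₁len : 0 < R₁.length := by
    refine Nat.pos_of_ne_zero fun h0 => ?_
    have h1 : s₁ = f h := Walk.eq_of_length_eq_zero h0
    exact hAB s₁ A.end_mem_support (h1 ▸ B.start_mem_support)
  refine ⟨s₁, (R₁.append (B.append (Walk.cons huj.symm R₂))).append A,
    hRBC.isCycle_append hA ?_ ?_, ?_⟩
  · intro z hz hz'
    have hzA := List.mem_of_mem_tail hz'
    have hz₂ : z ≠ s₂ := by
      rintro rfl
      have h1 := hA.support_nodup
      rw [← Walk.cons_tail_support] at h1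
      exact (List.nodup_cons.1 h1).1 hz'
    have hz₁ : z ≠ s₁ := by
      rintro rfl
      have h1 := hRBC.support_nodup
      rw [← Walk.cons_tail_support] at h1
      exact (List.nodup_cons.1 h1).1 hz
    have hzS : z ∉ S₁ ∪ S₂ := fun h' => (hAP z hzA h').elim hz₁ hz₂
    rcases (Walk.mem_support_append_iff _ _).1 (List.mem_of_mem_tail hz) with h' | h'
    · exact hzS (Or.inl (hR₁s z h'))
    rcases (Walk.mem_support_append_iff _ _).1 h' with h' | h'
    · exact hAB z hzA h'
    rcases List.mem_cons.1 h' with rfl | h'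
    · exact hAB _ hzA B.end_mem_support
    · exact hzS (Or.inr (hR₂s z h'))
  · left
    simp only [Walk.length_append, Walk.length_cons]
    omega
  · simp only [Walk.length_append, Walk.length_cons]
    omega

end IsVertexPath

/-- The Claim in the proof of Theorem 1.6: if `G` is 2-connected with circumference at most
`2k + 1` and `P = x_1 … x_m` is a longest path with `m ≥ 2k + 2` vertices whose endpoints
both have degree at least `k`, then the largest index of a neighbor of `x_1` on `P` is at
least the smallest index of a neighbor of `x_m` on `P`. -/
theorem stmt_5 {V : Type*} [Fintype V] (G : SimpleGraph V) (k : ℕ)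
    (h2c : TwoConnected G) (hcirc : circumference G ≤ 2 * k + 1)
    (x y : V) (p : G.Walk x y) (hp : p.IsPath)
    (hlongest : ∀ (u v : V) (q : G.Walk u v), q.IsPath → q.length ≤ p.length)
    (hm : 2 * k + 2 ≤ p.length + 1)
    (hdx : k ≤ gdeg G x) (hdy : k ≤ gdeg G y) :
    sInf {w : ℕ | w ≤ p.length ∧ G.Adj y (p.getVert w)} ≤
      sSup {w : ℕ | w ≤ p.length ∧ G.Adj x (p.getVert w)} := by
  classical
  have hf : IsVertexPath G p.getVert p.length :=
    ⟨fun i hi => p.adj_getVert_succ hi, fun i hi j hj h => hp.getVert_injOn hi hj h⟩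
  have hx : ∀ v, G.Adj x v → ∃ w ≤ p.length, p.getVert w = v := by
    intro v hv
    have hmem : v ∈ p.support := by
      by_contra h
      have := hlongest v y (Walk.cons hv.symm p) (hp.cons h)
      simp at this
    obtain ⟨w, h1, h2⟩ := Walk.mem_support_iff_exists_getVert.1 hmem
    exact ⟨w, h2, h1⟩
  have hy : ∀ v, G.Adj y v → ∃ w ≤ p.length, p.getVert w = v := by
    intro v hv
    have hmem : v ∈ p.support := by
      by_contra h
      have := hlongest v x (Walk.cons hv.symm p.reverse) (hp.reverse.cons (by simpa using h))
      simp at this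
    obtain ⟨w, h1, h2⟩ := Walk.mem_support_iff_exists_getVert.1 hmem
    exact ⟨w, h2, h1⟩
  have hx₁ : 1 ∈ {w : ℕ | w ≤ p.length ∧ G.Adj x (p.getVert w)} :=
    ⟨by omega, by simpa using p.adj_getVert_succ (i := 0) (by omega)⟩
  have hy₁ : p.length - 1 ∈ {w : ℕ | w ≤ p.length ∧ G.Adj y (p.getVert w)} := by
    refine ⟨by omega, ?_⟩
    have h := (p.adj_getVert_succ (i := p.length - 1) (by omega)).symm
    rwa [Nat.sub_add_cancel (by omega), p.getVert_length] at h
  have hbdd : BddAbove {w : ℕ | w ≤ p.length ∧ G.Adj x (p.getVert w)} :=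
    ⟨p.length, fun w hw => hw.1⟩
  by_contra! hlt
  obtain ⟨-, hadj₀⟩ := Nat.sSup_mem ⟨1, hx₁⟩ hbdd
  obtain ⟨-, hadj₁⟩ := Nat.sInf_mem ⟨_, hy₁⟩
  have hg := le_csSup hbdd hx₁
  have hh := Nat.sInf_le hy₁
  obtain ⟨v, c, hc, hlen⟩ := hf.exists_isCycle h2c (by omega) hlt (by omega)
    (by simpa using hadj₀)
    (by
      intro v hv
      rw [p.getVert_zero] at hv
      obtain ⟨w, hw, rfl⟩ := hx v hv
      exact ⟨w, le_csSup hbdd ⟨hw, hv⟩, rfl⟩)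
    (by simpa using hadj₁)
    (by
      intro v hv
      rw [p.getVert_length] at hv
      obtain ⟨w, hw, rfl⟩ := hy v hv
      exact ⟨w, Nat.sInf_le ⟨hw, hv⟩, hw, rfl⟩)
  have hcl := circumference_ge hc
  rw [p.getVert_zero, p.getVert_length] at hlen
  unfold gdeg at hdx hdy
  omega
end

section
/- Let G be a 2-connected graph on n vertices. If the minimum degree δ(G) ≥ k, then the circumference of G satisfies c(G) ≥ min{2k, n}. -/
open SimpleGraph

namespace SimpleGraph.Walk

variable {V : Type*} {G : SimpleGraph V} {u v w : V}

lemma IsPath.eq_of_mem_of_append {p : G.Walk u v} {q : G.Walk v w} (h : (p.append q).IsPath)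
    {x : V} (hp : x ∈ p.support) (hq : x ∈ q.support) : x = v := by
  by_contra hx
  exact h.ne_of_mem_support_of_append hx hp hq rfl

lemma IsPath.append_of_inter_s6 {p : G.Walk u v} {q : G.Walk v w} (hp : p.IsPath) (hq : q.IsPath)
    (h : ∀ x ∈ p.support, x ∈ q.support → x = v) : (p.append q).IsPath := by
  rw [isPath_def, support_append, List.nodup_append']
  have hq' := hq.support_nodup
  rw [← cons_tail_support, List.nodup_cons] at hq'
  refine ⟨hp.support_nodup, hq'.2, fun x hx hxq ↦ hq'.1 ?_⟩
  rwa [h x hx (List.mem_of_mem_tail hxq)] at hxq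

/-- Split a walk at its first vertex satisfying `P`. -/
lemma exists_append_first (P : V → Prop) (p : G.Walk u v) (h : ∃ x ∈ p.support, P x) :
    ∃ (x : V) (q : G.Walk u x) (r : G.Walk x v), p = q.append r ∧ P x ∧
      ∀ y ∈ q.support, P y → y = x := by
  induction p with
  | nil =>
    obtain ⟨x, hx, hP⟩ := h
    obtain rfl : x = _ := by simpa using hx
    exact ⟨_, nil, nil, rfl, hP, by simp⟩
  | @cons a b c hab p ih =>
    by_cases ha : P a
    · exact ⟨a, nil, cons hab p, rfl, ha, by simp⟩
    · obtain ⟨x, q, r, rfl, hx, hq⟩ := ih (by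
        obtain ⟨x, hx, hP⟩ := h
        rcases List.mem_cons.1 hx with rfl | hx
        · exact absurd hP ha
        · exact ⟨x, hx, hP⟩)
      refine ⟨x, cons hab q, r, rfl, hx, fun y hy hP ↦ ?_⟩
      rcases List.mem_cons.1 hy with rfl | hy
      · exact absurd hP ha
      · exact hq y hy hP

/-- Split a walk at its last vertex satisfying `P`. -/
lemma exists_append_last (P : V → Prop) (p : G.Walk u v) (h : ∃ x ∈ p.support, P x) :
    ∃ (x : V) (q : G.Walk u x) (r : G.Walk x v), p = q.append r ∧ P x ∧
      ∀ y ∈ r.support, P y → y = x := by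
  obtain ⟨x, q, r, hqr, hx, hq⟩ := p.reverse.exists_append_first P (by simpa using h)
  refine ⟨x, r.reverse, q.reverse, ?_, hx, by simpa using hq⟩
  rw [← reverse_append, ← hqr, reverse_reverse]

/-- An `A`-`B` path: a path meeting `A` exactly in its start and `B` exactly in its end. -/
structure IsLink (A B : Set V) (p : G.Walk u v) : Prop where
  isPath : p.IsPath
  start_mem : u ∈ A
  end_mem : v ∈ B
  eq_start : ∀ x ∈ p.support, x ∈ A → x = u
  eq_end : ∀ x ∈ p.support, x ∈ B → x = v

lemma exists_isLink {A B : Set V} (p : G.Walk u v) (hu : u ∈ A) (hv : v ∈ B) :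
    ∃ (a b : V) (q : G.Walk a b), q.IsLink A B ∧ q.support ⊆ p.support := by
  classical
  obtain ⟨b, q, r, hqr, hb, hq⟩ := p.bypass.exists_append_first (· ∈ B) ⟨v, by simp, hv⟩
  obtain ⟨a, s, t, rfl, ha, ht⟩ := q.exists_append_last (· ∈ A) ⟨u, by simp, hu⟩
  have hpath : ((s.append t).append r).IsPath := hqr ▸ p.bypass_isPath
  refine ⟨a, b, t, ⟨hpath.of_append_left.of_append_right, ha, hb, ht, fun x hx ↦ hq x ?_⟩, ?_⟩
  · exact support_subset_support_append_right _ _ hx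
  · intro x hx
    apply p.support_bypass_subset_support
    rw [hqr]
    exact support_subset_support_append_left _ _ (support_subset_support_append_right _ _ hx)

lemma IsLink.append {A B B' : Set V} {q : G.Walk u v} {e : G.Walk v w} (hq : q.IsLink A B')
    (he : e.IsPath) (hw : w ∈ B) (heA : ∀ x ∈ e.support, x ∈ A → x = v)
    (heB : ∀ x ∈ e.support, x ∈ B → x = w) (hsub : ∀ x ∈ e.support, x ∈ B') (hB : B ⊆ B') :
    (q.append e).IsLink A B where
  isPath := hq.isPath.append_of_inter_s6 he fun x hx hxe ↦ hq.eq_end x hx (hsub x hxe)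
  start_mem := hq.start_mem
  end_mem := hw
  eq_start x hx hA := by
    rcases (mem_support_append_iff ..).1 hx with hx | hx
    · exact hq.eq_start x hx hA
    · obtain rfl := heA x hx hA
      exact hq.eq_start x (end_mem_support _) hA
  eq_end x hx hxB := by
    rcases (mem_support_append_iff ..).1 hx with hx | hx
    · obtain rfl := hq.eq_end x hx (hB hxB)
      exact heB x (start_mem_support _) hxB
    · exact heB x hx hxB

end SimpleGraph.Walk

namespace SimpleGraph

variable {V : Type*} {G : SimpleGraph V}

open Walk

/-- Given a link `p` from `a` to `b` and a link `r` from `A` to `B` avoiding `b` whose last common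
vertex with `p` is `z`, every `y ≠ z` in `B`, on `p` after `z`, or on `r` after `z` can be joined
to `B` disjointly from a path joining `z` to `B`, with one of the two paths ending at `b`. -/
lemma exists_disjoint_tails {A B : Set V} {a b c d z y : V} {p₁ : G.Walk a z} {p₂ : G.Walk z b}
    {r₁ : G.Walk c z} {r₂ : G.Walk z d} (hp : (p₁.append p₂).IsLink A B)
    (hr : (r₁.append r₂).IsLink A B)
    (hz : ∀ x ∈ r₂.support, x ∈ p₂.support → x = z)
    (hy : y ∈ B ∪ {x | x ∈ p₂.support} ∪ {x | x ∈ r₂.support}) (hyz : y ≠ z) :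
    ∃ (b₁ b₂ : V) (e₁ : G.Walk z b₁) (e₂ : G.Walk y b₂), (b₁ = b ∨ b₂ = b) ∧
      e₁.support.Disjoint e₂.support ∧
      (e₁.IsPath ∧ b₁ ∈ B ∧ (∀ x ∈ e₁.support, x ∈ A → x = z) ∧
        (∀ x ∈ e₁.support, x ∈ B → x = b₁) ∧
        ∀ x ∈ e₁.support, x ∈ B ∪ {x | x ∈ p₂.support} ∪ {x | x ∈ r₂.support}) ∧
      (e₂.IsPath ∧ b₂ ∈ B ∧ (∀ x ∈ e₂.support, x ∈ A → x = y) ∧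
        (∀ x ∈ e₂.support, x ∈ B → x = b₂) ∧
        ∀ x ∈ e₂.support, x ∈ B ∪ {x | x ∈ p₂.support} ∪ {x | x ∈ r₂.support}) := by
  have hp₂ := hp.isPath.of_append_right
  have hr₂ := hr.isPath.of_append_right
  have hpA : ∀ x ∈ p₂.support, x ∈ A → x = z := fun x hx hA ↦ by
    obtain rfl := hp.eq_start x (support_subset_support_append_right _ _ hx) hA
    exact hp.isPath.eq_of_mem_of_append (start_mem_support _) hx
  have hrA : ∀ x ∈ r₂.support, x ∈ A → x = z := fun x hx hA ↦ by
    obtain rfl := hr.eq_start x (support_subset_support_append_right _ _ hx) hA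
    exact hr.isPath.eq_of_mem_of_append (start_mem_support _) hx
  have hpB : ∀ x ∈ p₂.support, x ∈ B → x = b := fun x hx ↦
    hp.eq_end x (support_subset_support_append_right _ _ hx)
  have hrB : ∀ x ∈ r₂.support, x ∈ B → x = d := fun x hx ↦
    hr.eq_end x (support_subset_support_append_right _ _ hx)
  by_cases hyp : y ∈ p₂.support
  · obtain ⟨s, t, rfl⟩ := mem_support_iff_exists_append.1 hyp
    have hsub : ∀ x ∈ t.support, x ∈ (s.append t).support :=
      fun x hx ↦ support_subset_support_append_right _ _ hx
    have hzt : z ∉ t.support := fun h ↦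
      hyz (hp₂.eq_of_mem_of_append (start_mem_support _) h).symm
    refine ⟨d, b, r₂, t, .inr rfl, fun x hx hx' ↦ ?_, ⟨hr₂, hr.end_mem, hrA, hrB, by grind⟩,
      hp₂.of_append_right, hp.end_mem, by grind, by grind, by grind⟩
    exact hzt (hz x hx (hsub x hx') ▸ hx')
  by_cases hyr : y ∈ r₂.support
  · obtain ⟨s, t, rfl⟩ := mem_support_iff_exists_append.1 hyr
    have hsub : ∀ x ∈ t.support, x ∈ (s.append t).support :=
      fun x hx ↦ support_subset_support_append_right _ _ hx
    have hzt : z ∉ t.support := fun h ↦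
      hyz (hr₂.eq_of_mem_of_append (start_mem_support _) h).symm
    refine ⟨b, d, p₂, t, .inl rfl, fun x hx hx' ↦ ?_, ⟨hp₂, hp.end_mem, hpA, hpB, by grind⟩,
      hr₂.of_append_right, hr.end_mem, by grind, by grind, by grind⟩
    exact hzt (hz x (hsub x hx') hx ▸ hx')
  · have hyB : y ∈ B := by grind
    refine ⟨b, y, p₂, nil, .inl rfl, fun x hx hx' ↦ ?_, ⟨hp₂, hp.end_mem, hpA, hpB, by grind⟩,
      .nil, hyB, by simp, by simp, ?_⟩
    · obtain rfl : x = y := by simpa using hx'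
      exact hyp hx
    · simpa using hy

/-- Menger's theorem for two paths, in augmenting form: if no single vertex separates `A` from
`B`, then an `A`-`B` path from `a` to `b` can be replaced by two disjoint `A`-`B` paths, one
starting at `a` and one ending at `b`. -/
lemma exists_disjoint_isLink [Finite V]
    (h : ∀ c u v : V, u ≠ c → v ≠ c → ∃ q : G.Walk u v, c ∉ q.support) {A B : Set V}
    (hA : A.Nontrivial) (hB : B.Nontrivial) {a b : V} (p : G.Walk a b) (hp : p.IsLink A B) :
    ∃ (s t₁ t₂ : V) (q₁ : G.Walk a t₁) (q₂ : G.Walk s t₂), (t₁ = b ∨ t₂ = b) ∧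
      q₁.IsLink A B ∧ q₂.IsLink A B ∧ q₁.support.Disjoint q₂.support := by
  obtain ⟨n, hn⟩ : ∃ n, Bᶜ.ncard = n := ⟨_, rfl⟩
  induction n using Nat.strong_induction_on generalizing B b with
  | _ n ih =>
    obtain ⟨u, hu, hub⟩ := hA.exists_ne b
    obtain ⟨v, hv, hvb⟩ := hB.exists_ne b
    obtain ⟨r₀, hr₀⟩ := h b u v hub hvb
    obtain ⟨c, d, r, hr, hrs⟩ := r₀.exists_isLink hu hv
    have hbr : b ∉ r.support := fun hb ↦ hr₀ (hrs hb)
    by_cases hdisj : ∃ x ∈ r.support, x ∈ p.support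
    · obtain ⟨z, r₁, r₂, rfl, hzp, hz⟩ := r.exists_append_last (· ∈ p.support) hdisj
      obtain ⟨p₁, p₂, rfl⟩ := mem_support_iff_exists_append.1 hzp
      have hzb : z ≠ b := by
        rintro rfl
        simp at hbr
      set B' := B ∪ {x | x ∈ p₂.support} ∪ {x | x ∈ r₂.support} with hB'
      have hsub : B ⊆ B' := fun x hx ↦ .inl (.inl hx)
      have hzB : z ∉ B := fun hzB ↦ hzb (hp.eq_end z hzp hzB)
      have hzB' : z ∈ B' := .inl (.inr (start_mem_support _))
      have hlt : B'ᶜ.ncard < n := by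
        rw [← hn]
        refine Set.ncard_lt_ncard ⟨Set.compl_subset_compl.2 hsub, fun hss ↦ ?_⟩ (Set.toFinite _)
        exact hss hzB hzB'
      have hp₁ : p₁.IsLink A B' := by
        refine ⟨hp.isPath.of_append_left, hp.start_mem, hzB', fun x hx ↦
          hp.eq_start x (support_subset_support_append_left _ _ hx), fun x hx hxB ↦ ?_⟩
        have hxp := support_subset_support_append_left p₁ p₂ hx
        rcases hxB with (hxB | hxB) | hxB
        · obtain rfl := hp.eq_end x hxp hxB
          exact hp.isPath.eq_of_mem_of_append hx (end_mem_support _)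
        · exact hp.isPath.eq_of_mem_of_append hx hxB
        · exact hz x hxB hxp
      obtain ⟨s, t₁, t₂, q₁, q₂, ht, hq₁, hq₂, hq⟩ := ih _ hlt (hB.mono hsub) p₁ hp₁ rfl
      have htne : t₁ ≠ t₂ := fun he ↦ hq (end_mem_support q₁) (he ▸ end_mem_support q₂)
      have key : ∀ {b₁ b₂ : V} (e₁ : G.Walk t₁ b₁) (e₂ : G.Walk t₂ b₂),
          e₁.support.Disjoint e₂.support → (∀ x ∈ e₁.support, x ∈ B') →
          (∀ x ∈ e₂.support, x ∈ B') →
          (q₁.append e₁).support.Disjoint (q₂.append e₂).support := by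
        intro b₁ b₂ e₁ e₂ he h₁ h₂ x hx₁ hx₂
        rcases (mem_support_append_iff ..).1 hx₁ with hx₁ | hx₁ <;>
          rcases (mem_support_append_iff ..).1 hx₂ with hx₂ | hx₂
        · exact hq hx₁ hx₂
        · obtain rfl := hq₁.eq_end x hx₁ (h₂ x hx₂)
          exact he (start_mem_support _) hx₂
        · obtain rfl := hq₂.eq_end x hx₂ (h₁ x hx₁)
          exact he hx₁ (start_mem_support _)
        · exact he hx₁ hx₂
      have hzp₂ : ∀ x ∈ r₂.support, x ∈ p₂.support → x = z := fun x hx hxp ↦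
        hz x hx (support_subset_support_append_right _ _ hxp)
      rcases ht with rfl | rfl
      · obtain ⟨b₁, b₂, e₁, e₂, hb, he, ⟨h₁, h₁B, h₁A, h₁B', h₁s⟩, h₂, h₂B, h₂A, h₂B', h₂s⟩ :=
          exists_disjoint_tails hp hr hzp₂ hq₂.end_mem htne.symm
        exact ⟨s, b₁, b₂, q₁.append e₁, q₂.append e₂, hb,
          hq₁.append h₁ h₁B h₁A h₁B' h₁s hsub, hq₂.append h₂ h₂B h₂A h₂B' h₂s hsub,
          key e₁ e₂ he h₁s h₂s⟩
      · obtain ⟨b₁, b₂, e₁, e₂, hb, he, ⟨h₁, h₁B, h₁A, h₁B', h₁s⟩, h₂, h₂B, h₂A, h₂B', h₂s⟩ :=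
          exists_disjoint_tails hp hr hzp₂ hq₁.end_mem htne
        exact ⟨s, b₂, b₁, q₁.append e₂, q₂.append e₁, hb.symm,
          hq₁.append h₂ h₂B h₂A h₂B' h₂s hsub, hq₂.append h₁ h₁B h₁A h₁B' h₁s hsub,
          key e₂ e₁ he.symm h₂s h₁s⟩
    · exact ⟨c, b, d, p, r, .inl rfl, hp, hr, fun x hx hx' ↦ hdisj ⟨x, hx', hx⟩⟩

end SimpleGraph

namespace SimpleGraph

variable {V : Type*} {G : SimpleGraph V} {u v : V}

open Walk

lemma length_le_circumference [Finite V] {c : G.Walk v v} (hc : c.IsCycle) :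
    c.length ≤ circumference G := by
  have := Fintype.ofFinite V
  refine le_csSup ⟨Fintype.card V, ?_⟩ ⟨v, c, hc, rfl⟩
  rintro _ ⟨w, d, hd, rfl⟩
  simpa using hd.support_nodup.length_le_card

lemma length_add_length_le_circumference [Finite V] {p : G.Walk u v} {q : G.Walk v u}
    (hp : p.IsPath) (hq : q.IsPath) (hlen : 2 ≤ p.length)
    (h : ∀ x ∈ p.support, x ∈ q.support → x = u ∨ x = v) :
    p.length + q.length ≤ circumference G := by
  rw [← length_append]
  refine length_le_circumference (hp.isCycle_append hq (fun x hx hx' ↦ ?_) (.inl hlen))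
  have hu := hp.support_nodup
  have hv := hq.support_nodup
  rw [← cons_tail_support, List.nodup_cons] at hu hv
  rcases h x (List.mem_of_mem_tail hx) (List.mem_of_mem_tail hx') with rfl | rfl
  · exact hu.1 hx
  · exact hv.1 hx'

/-- In a path `p` from `x` to `z` with `x` adjacent to `z`, every `s ≠ z` on `p` can be joined
to `z` by a path within `p` through all neighbors of `x` on `p`. -/
lemma exists_isPath_through_neighbors {x z s : V} {p : G.Walk x z} (hp : p.IsPath)
    (hxz : G.Adj x z) (hs : s ∈ p.support) (hsz : s ≠ z) :
    ∃ q : G.Walk s z, q.IsPath ∧ (∀ w ∈ q.support, w ∈ p.support) ∧ x ∈ q.support ∧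
      ∀ w ∈ p.support, G.Adj x w → w ∈ q.support := by
  obtain ⟨p₁, p₂, rfl⟩ := mem_support_iff_exists_append.1 hs
  obtain ⟨w, q₁, q₂, rfl, ⟨hxw, hws⟩, hq₁⟩ :=
    p₂.exists_append_first (fun w ↦ G.Adj x w ∧ w ≠ s) ⟨z, by simp, hxz, hsz.symm⟩
  have hpw : ∀ t ∈ p₁.support, t ∉ q₂.support := by
    intro t ht ht'
    obtain rfl := hp.eq_of_mem_of_append ht (support_subset_support_append_right _ _ ht')
    exact hws (hp.of_append_right.eq_of_mem_of_append (start_mem_support _) ht').symm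
  refine ⟨p₁.reverse.append (cons hxw q₂), ?_, ?_, ?_, ?_⟩
  · refine hp.of_append_left.reverse.append_of_inter_s6
      (hp.of_append_right.of_append_right.cons (hpw x (start_mem_support _))) fun t ht ht' ↦ ?_
    have ht : t ∈ p₁.support := by simpa using ht
    exact (List.mem_cons.1 ht').resolve_right (hpw t ht)
  · intro t ht
    simp only [mem_support_append_iff, support_reverse, List.mem_reverse, support_cons,
      List.mem_cons] at ht ⊢
    rcases ht with ht | rfl | ht
    · exact .inl ht
    · exact .inl (start_mem_support _)
    · exact .inr (.inr ht)
  · simp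
  · intro t ht hxt
    simp only [mem_support_append_iff, support_reverse, List.mem_reverse, support_cons,
      List.mem_cons] at ht ⊢
    rcases ht with ht | ht | ht
    · exact .inl ht
    · by_cases hts : t = s
      · exact .inl (hts ▸ end_mem_support p₁)
      · exact .inr (.inr (hq₁ t ht ⟨hxt, hts⟩ ▸ start_mem_support q₂))
    · exact .inr (.inr ht)

/-- If `i < j`, `x` is adjacent to the `j`-th vertex of a path `p` from `x` to `y` and `y` to the
`i`-th, then the vertices of `p` up to the `i`-th and from the `j`-th on form a cycle. -/
lemma exists_isCycle_of_crossing {x y : V} {p : G.Walk x y} (hp : p.IsPath) {i j : ℕ} (hij : i < j)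
    (hj : j ≤ p.length) (hlen : 1 ≤ i + (p.length - j)) (hxj : G.Adj x (p.getVert j))
    (hyi : G.Adj y (p.getVert i)) :
    ∃ (v : V) (c : G.Walk v v), c.IsCycle ∧ c.length = i + (p.length - j) + 2 := by
  have hdisj : ∀ t ∈ (p.take i).support, t ∉ (p.drop j).support := by
    intro t ht ht'
    obtain ⟨a, rfl, -⟩ := mem_support_iff_exists_getVert.1 ht
    obtain ⟨b, hb, hbl⟩ := mem_support_iff_exists_getVert.1 ht'
    rw [drop_length] at hbl
    rw [take_getVert, drop_getVert] at hb
    have := hp.getVert_injOn (by simp; lia) (by simp; lia) hb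
    lia
  have hq : ((p.take i).append (cons hyi.symm (p.drop j).reverse)).IsPath := by
    refine (hp.take i).append_of_inter_s6 ((hp.drop j).reverse.cons ?_) fun t ht ht' ↦ ?_
    · simpa using hdisj _ (end_mem_support _)
    · exact (List.mem_cons.1 ht').resolve_right (by simpa using hdisj t ht)
  refine ⟨_, _, hq.isCycle_append (q := cons hxj.symm nil) (.cons .nil ?_) ?_ (.inl ?_), ?_⟩
  · simpa using hxj.ne'
  · intro t ht ht'
    obtain rfl : t = x := by simpa using ht'
    have hu := hq.support_nodup
    rw [← cons_tail_support, List.nodup_cons] at hu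
    exact hu.1 ht
  · simp
    lia
  · simp
    lia

/-- A non-spanning cycle in a connected graph yields a path at least as long. -/
lemma Connected.exists_isPath_length_eq [Fintype V] (hG : G.Connected) {c : G.Walk v v}
    (hc : c.IsCycle) (hlt : c.length < Fintype.card V) :
    ∃ (a b : V) (p : G.Walk a b), p.IsPath ∧ p.length = c.length := by
  classical
  obtain ⟨w, hw⟩ : ∃ w, w ∉ c.support := by
    by_contra! hall
    have huniv : c.support.tail.toFinset = Finset.univ := by
      ext t
      have ht := hall t
      rw [← cons_tail_support, List.mem_cons] at ht
      simpa using ht.elim (fun h ↦ h ▸ end_mem_tail_support hc.not_nil) id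
    have := List.toFinset_card_le c.support.tail
    rw [huniv, Finset.card_univ] at this
    simp at this
    lia
  obtain ⟨q⟩ := hG.preconnected v w
  obtain ⟨d, -, hd, hd'⟩ := q.exists_boundary_dart {t | t ∈ c.support} (start_mem_support _) hw
  have hrot := hc.rotate hd
  refine ⟨_, _, (c.rotate d.fst hd).tail.concat d.adj, hrot.isPath_tail.concat ?_ _, ?_⟩
  · intro hmem
    rw [support_tail_of_not_nil _ hrot.not_nil] at hmem
    have := List.mem_of_mem_tail hmem
    rw [mem_support_rotate_iff] at this
    exact hd' this
  · rw [length_concat, length_tail_add_one hrot.not_nil, length_rotate]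

/-- If no end-neighbors cross along a longest path, then the two ends and all their neighbors
lie on a common cycle. -/
lemma two_mul_le_circumference_of_not_crossing [Finite V]
    (h : ∀ c u v : V, u ≠ c → v ≠ c → ∃ q : G.Walk u v, c ∉ q.support) {k : ℕ} (hk : 2 ≤ k)
    (hdeg : ∀ v, k ≤ gdeg G v) {x y : V} {p : G.Walk x y} (hp : p.IsPath)
    (hx : ∀ w, G.Adj x w → w ∈ p.support) (hy : ∀ w, G.Adj y w → w ∈ p.support)
    (hcross : ∀ i j, i < j → j ≤ p.length → G.Adj x (p.getVert j) → ¬ G.Adj y (p.getVert i)) :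
    2 * k ≤ circumference G := by
  classical
  have hne : ∀ v, ∃ w, G.Adj v w := fun v ↦
    Set.nonempty_of_ncard_ne_zero (s := G.neighborSet v) (by
      have : k ≤ (G.neighborSet v).ncard := hdeg v
      lia)
  obtain ⟨z, p₁, p', rfl, hxz, hlast⟩ := p.exists_append_last (G.Adj x)
    (let ⟨w, hw⟩ := hne x; ⟨w, hx w hw, hw⟩)
  have hyp' : ∀ w, G.Adj y w → w ∈ p'.support := by
    intro w hw
    by_contra hwp
    have hw₁ := ((mem_support_append_iff ..).1 (hy w hw)).resolve_right hwp
    obtain ⟨i, rfl, hi⟩ := mem_support_iff_exists_getVert.1 hw₁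
    have hi' : i < p₁.length := lt_of_le_of_ne hi (by
      rintro rfl
      simp at hwp)
    refine hcross i p₁.length hi' (by simp) ?_ ?_
    · simpa [getVert_append] using hxz
    · simpa [getVert_append, hi'] using hw
  obtain ⟨w, m, p₂, rfl, hyw, hfirst⟩ := p'.exists_append_first (G.Adj y)
    (let ⟨w, hw⟩ := hne y; ⟨w, hyp' w hw, hw⟩)
  have hp' := hp.of_append_right
  have hp₁ := hp.of_append_left
  have hp₂ := hp'.of_append_right
  have hx₁ : ∀ t, G.Adj x t → t ∈ p₁.support := fun t ht ↦
    ((mem_support_append_iff ..).1 (hx t ht)).elim id fun h ↦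
      hlast t h ht ▸ end_mem_support p₁
  have hy₂ : ∀ t, G.Adj y t → t ∈ p₂.support := fun t ht ↦
    ((mem_support_append_iff ..).1 (hyp' t ht)).elim
      (fun h ↦ hfirst t h ht ▸ start_mem_support p₂) id
  have hAB : ∀ t ∈ p₁.support, t ∈ p₂.support → t = z ∧ t = w := by
    intro t h₁ h₂
    obtain rfl := hp.eq_of_mem_of_append h₁ (support_subset_support_append_right _ _ h₂)
    exact ⟨rfl, hp'.eq_of_mem_of_append (start_mem_support _) h₂⟩
  have hm : m.IsLink {t | t ∈ p₁.support} {t | t ∈ p₂.support} :=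
    ⟨hp'.of_append_left, end_mem_support _, start_mem_support _,
      fun t ht ht' ↦ hp.eq_of_mem_of_append ht' (support_subset_support_append_left _ _ ht),
      fun t ht ht' ↦ hp'.eq_of_mem_of_append ht ht'⟩
  obtain ⟨s, t₁, t₂, q₁, q₂, ht, hq₁, hq₂, hq⟩ := exists_disjoint_isLink h
    ⟨x, start_mem_support _, z, end_mem_support _, hxz.ne⟩
    ⟨w, start_mem_support _, y, end_mem_support _, hyw.ne'⟩ m hm
  have hsz : s ≠ z := by
    rintro rfl
    exact hq (start_mem_support _) (start_mem_support _)
  have htt : t₁ ≠ t₂ := by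
    rintro rfl
    exact hq (end_mem_support _) (end_mem_support _)
  obtain ⟨l, hl, hlsub, hxl, hlN⟩ :=
    exists_isPath_through_neighbors hp₁ hxz hq₂.start_mem hsz
  obtain ⟨r, hr, hrsub, hyr, hrN⟩ : ∃ r : G.Walk t₁ t₂, r.IsPath ∧
      (∀ t ∈ r.support, t ∈ p₂.support) ∧ y ∈ r.support ∧
      ∀ t ∈ p₂.support, G.Adj y t → t ∈ r.support := by
    rcases ht with rfl | rfl
    · obtain ⟨r, hr, hrsub, hyr, hrN⟩ := exists_isPath_through_neighbors hp₂.reverse hyw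
        (by simpa using hq₂.end_mem) htt.symm
      exact ⟨r.reverse, hr.reverse, by simpa using hrsub, by simpa using hyr, by simpa using hrN⟩
    · obtain ⟨r, hr, hrsub, hyr, hrN⟩ := exists_isPath_through_neighbors hp₂.reverse hyw
        (by simpa using hq₁.end_mem) htt
      exact ⟨r, hr, by simpa using hrsub, by simpa using hyr, by simpa using hrN⟩
  have hq₁r : (q₁.append r).IsPath := hq₁.isPath.append_of_inter_s6 hr fun t h₁ h₂ ↦
    hq₁.eq_end t h₁ (hrsub t h₂)
  have hC : (l.append (q₁.append r)).IsPath := hl.append_of_inter_s6 hq₁r fun t h₁ h₂ ↦ by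
    rcases (mem_support_append_iff ..).1 h₂ with h₂ | h₂
    · exact hq₁.eq_start t h₂ (hlsub t h₁)
    · exact (hAB t (hlsub t h₁) (hrsub t h₂)).1
  have hinter : ∀ t ∈ (l.append (q₁.append r)).support, t ∈ q₂.reverse.support →
      t = s ∨ t = t₂ := by
    intro t h₁ h₂
    replace h₂ : t ∈ q₂.support := by simpa using h₂
    simp only [mem_support_append_iff] at h₁
    rcases h₁ with h₁ | h₁ | h₁
    · exact .inl (hq₂.eq_start t h₂ (hlsub t h₁))
    · exact (hq h₁ h₂).elim
    · exact .inr (hq₂.eq_end t h₂ (hrsub t h₁))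
  have hcount : 2 * k + 1 ≤ (l.append (q₁.append r)).length + 1 := by
    have hX : k + 1 ≤ (insert x (G.neighborSet x)).ncard := by
      rw [Set.ncard_insert_of_notMem (by simp)]
      exact Nat.succ_le_succ (hdeg x)
    have hY : k + 1 ≤ (insert y (G.neighborSet y)).ncard := by
      rw [Set.ncard_insert_of_notMem (by simp)]
      exact Nat.succ_le_succ (hdeg y)
    have hXY : (insert x (G.neighborSet x) ∩ insert y (G.neighborSet y)).ncard ≤ 1 := by
      rw [← Set.ncard_singleton z]
      refine Set.ncard_le_ncard ?_ (Set.toFinite _)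
      rintro t ⟨h₁, h₂⟩
      refine (hAB t ?_ ?_).1
      · rcases h₁ with rfl | h₁
        exacts [start_mem_support _, hx₁ t h₁]
      · rcases h₂ with rfl | h₂
        exacts [end_mem_support _, hy₂ t h₂]
    have hU := Set.ncard_union_add_ncard_inter (insert x (G.neighborSet x))
      (insert y (G.neighborSet y))
    have hsub : insert x (G.neighborSet x) ∪ insert y (G.neighborSet y) ⊆
        ((l.append (q₁.append r)).support.toFinset : Set V) := by
      intro t ht
      simp only [List.coe_toFinset, Set.mem_ofPred_eq, mem_support_append_iff]
      rcases ht with (rfl | ht) | (rfl | ht)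
      · exact .inl hxl
      · exact .inl (hlN t (hx₁ t ht) ht)
      · exact .inr (.inr hyr)
      · exact .inr (.inr (hrN t (hy₂ t ht) ht))
    have := Set.ncard_le_ncard hsub (Set.toFinite _)
    rw [Set.ncard_coe_finset] at this
    have h' := List.toFinset_card_le (l.append (q₁.append r)).support
    rw [length_support] at h'
    lia
  have := length_add_length_le_circumference hC hq₂.isPath.reverse (by lia) hinter
  lia

/-- If end-neighbors cross along a longest path, a closest crossing gives a cycle which is
spanning or has length at least `2 * k`. -/
lemma min_le_circumference_of_crossing [Fintype V] (hG : G.Connected) {k : ℕ} (hk : 2 ≤ k)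
    (hdeg : ∀ v, k ≤ gdeg G v) {x y : V} {p : G.Walk x y} (hp : p.IsPath)
    (hmax : ∀ (u v : V) (q : G.Walk u v), q.IsPath → q.length ≤ p.length)
    (hx : ∀ w, G.Adj x w → w ∈ p.support) (hy : ∀ w, G.Adj y w → w ∈ p.support)
    (hcross : ∃ i j, i < j ∧ j ≤ p.length ∧ G.Adj x (p.getVert j) ∧ G.Adj y (p.getVert i)) :
    min (2 * k) (Fintype.card V) ≤ circumference G := by
  classical
  have hmin : ∃ d i j, j = i + d ∧ i < j ∧ j ≤ p.length ∧ G.Adj x (p.getVert j) ∧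
      G.Adj y (p.getVert i) := by
    obtain ⟨i, j, hij, hr⟩ := hcross
    exact ⟨j - i, i, j, by lia, hij, hr⟩
  obtain ⟨i, j, hd, hij, hj, hxj, hyi⟩ := Nat.find_spec hmin
  have hbest : ∀ i' j', i' < j' → j' ≤ p.length → G.Adj x (p.getVert j') →
      G.Adj y (p.getVert i') → j - i ≤ j' - i' := by
    intro i' j' h₁ h₂ h₃ h₄
    have := Nat.find_min' hmin ⟨i', j', (by lia : j' = i' + (j' - i')), h₁, h₂, h₃, h₄⟩
    lia
  set S := {a ∈ Finset.range p.length | G.Adj x (p.getVert (a + 1))} with hS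
  set T := {a ∈ Finset.range p.length | G.Adj y (p.getVert a)} with hT
  have hkS : k ≤ S.card := by
    refine (hdeg x).trans ?_
    rw [← Set.ncard_coe_finset]
    refine (Set.ncard_le_ncard (t := (fun a ↦ p.getVert (a + 1)) '' S) ?_).trans
      (Set.ncard_image_le S.finite_toSet)
    intro w hw
    obtain ⟨a, rfl, ha⟩ := mem_support_iff_exists_getVert.1 (hx w hw)
    rcases a with _ | a
    · simp at hw
    · exact ⟨a, by simpa [hS] using ⟨ha, hw⟩, rfl⟩
  have hkT : k ≤ T.card := by
    refine (hdeg y).trans ?_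
    rw [← Set.ncard_coe_finset]
    refine (Set.ncard_le_ncard (t := p.getVert '' T) ?_).trans
      (Set.ncard_image_le T.finite_toSet)
    intro w hw
    obtain ⟨a, rfl, ha⟩ := mem_support_iff_exists_getVert.1 (hy w hw)
    have ha' : a < p.length := lt_of_le_of_ne ha (by
      rintro rfl
      simp at hw)
    exact ⟨a, by simpa [hT] using ⟨ha', hw⟩, rfl⟩
  by_cases hone : j = i + 1
  · have hSl : S.card ≤ p.length := by simpa using Finset.card_filter_le (Finset.range p.length) _
    obtain ⟨v, c, hc, hcl⟩ := exists_isCycle_of_crossing hp hij hj (by lia) hxj hyi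
    have hcard : Fintype.card V ≤ c.length := by
      by_contra! hlt
      obtain ⟨a, b, q, hq, hql⟩ := hG.exists_isPath_length_eq hc hlt
      have := hmax a b q hq
      lia
    exact (min_le_right _ _).trans (hcard.trans (length_le_circumference hc))
  · have hST : Disjoint S T := by
      rw [Finset.disjoint_left]
      intro a ha hb
      simp only [hS, hT, Finset.mem_filter, Finset.mem_range] at ha hb
      have := hbest a (a + 1) (by lia) (by lia) ha.2 hb.2
      lia
    have hsub : S ∪ T ⊆ Finset.range (i + 1) ∪ Finset.Ico (j - 1) p.length := by
      intro a ha
      simp only [Finset.mem_union, Finset.mem_range, Finset.mem_Ico, hS, hT,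
        Finset.mem_filter] at ha ⊢
      by_contra! hcon
      rcases ha with ⟨ha, hadj⟩ | ⟨ha, hadj⟩
      · have := hbest i (a + 1) (by lia) (by lia) hadj hyi
        lia
      · have := hbest a j (by lia) hj hxj hadj
        lia
    have hle := (Finset.card_le_card hsub).trans (Finset.card_union_le _ _)
    rw [Finset.card_union_of_disjoint hST, Finset.card_range, Nat.card_Ico] at hle
    obtain ⟨v, c, hc, hcl⟩ := exists_isCycle_of_crossing hp hij hj (by lia) hxj hyi
    have := length_le_circumference hc
    exact (min_le_left _ _).trans (by lia)

end SimpleGraph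

namespace TwoConnected

variable {V : Type*} {G : SimpleGraph V}

lemma exists_walk_avoiding (h : TwoConnected G) (c u v : V) (hu : u ≠ c) (hv : v ≠ c) :
    ∃ q : G.Walk u v, c ∉ q.support := by
  obtain ⟨q⟩ := (h.2 c).preconnected ⟨u, hu⟩ ⟨v, hv⟩
  have hq : c ∉ (q.map (Embedding.induce _).toHom).support := by
    rw [Walk.support_map, List.mem_map]
    rintro ⟨⟨w, hw⟩, -, hwc⟩
    exact hw hwc
  exact ⟨_, hq⟩

lemma exists_ne_ne (h : TwoConnected G) (u v : V) : ∃ c, c ≠ u ∧ c ≠ v := by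
  by_contra! hall
  have hcard := h.1
  have := Set.ncard_insert_le u {v}
  have huniv : ({u, v} : Set V) = Set.univ :=
    Set.eq_univ_of_forall fun c ↦ or_iff_not_imp_left.2 (hall c)
  rw [huniv, Set.ncard_univ, Set.ncard_singleton] at this
  lia

lemma connected [Finite V] (h : TwoConnected G) : G.Connected := by
  have hcard := h.1
  have : Nonempty V := (Nat.card_pos_iff.1 (by lia)).1
  refine ⟨fun u v ↦ ?_⟩
  obtain ⟨c, hcu, hcv⟩ := h.exists_ne_ne u v
  exact (h.exists_walk_avoiding c u v hcu.symm hcv.symm).elim fun q _ ↦ q.reachable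

lemma two_le_gdeg [Finite V] (h : TwoConnected G) (v : V) : 2 ≤ gdeg G v := by
  have hcard := h.1
  have : Nontrivial V := Finite.one_lt_card_iff_nontrivial.1 (by lia)
  obtain ⟨w, hw⟩ := h.connected.preconnected.exists_adj_of_nontrivial v
  obtain ⟨u, hu⟩ := h.exists_ne_ne v w
  obtain ⟨q, hq⟩ := h.exists_walk_avoiding w v u hw.ne hu.2
  have hnil : ¬ q.Nil := Walk.not_nil_of_ne (Ne.symm hu.1)
  refine (Set.one_lt_ncard_iff (Set.toFinite _)).2 ⟨w, q.snd, hw, q.adj_snd hnil, ?_⟩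
  rintro rfl
  exact hq (Walk.getVert_mem_support _ _)

end TwoConnected

/-- Dirac's theorem (Theorem 1.1): a 2-connected graph on `n` vertices with minimum degree
at least `k` has circumference at least `min {2k, n}`. -/
theorem stmt_6 {V : Type*} [Fintype V] (G : SimpleGraph V) (k : ℕ)
    (h2c : TwoConnected G) (hdelta : ∀ v : V, k ≤ gdeg G v) :
    min (2 * k) (Fintype.card V) ≤ circumference G := by
  wlog hk : 2 ≤ k generalizing k
  · exact (min_le_min_right _ (by lia)).trans (this 2 h2c.two_le_gdeg le_rfl)
  have := h2c.connected.nonempty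
  obtain ⟨x, y, p, hp, hmax⟩ :=
    Walk.exists_isPath_forall_isPath_length_le_length G
  have hx : ∀ w, G.Adj x w → w ∈ p.support := by
    intro w hw
    by_contra hwp
    have := hmax _ _ (.cons hw.symm p) (hp.cons hwp)
    simp at this
  have hy : ∀ w, G.Adj y w → w ∈ p.support := by
    intro w hw
    by_contra hwp
    have := hmax _ _ (p.concat hw) (hp.concat hwp hw)
    simp at this
  by_cases hcross : ∃ i j, i < j ∧ j ≤ p.length ∧ G.Adj x (p.getVert j) ∧ G.Adj y (p.getVert i)
  · exact min_le_circumference_of_crossing h2c.connected hk hdelta hp hmax hx hy hcross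
  · push Not at hcross
    exact (min_le_left _ _).trans (two_mul_le_circumference_of_not_crossing
      h2c.exists_walk_avoiding hk hdelta hp hx hy hcross)
end

section
/- Let G be a 2-connected graph on at least 4 vertices and let u and v be two distinct vertices of G. If every vertex of G other than u, v and at most one additional vertex has degree at least k, then G contains a (u, v)-path of length at least k. -/
open SimpleGraph

section BondyJackson

open Finset

variable {V : Type*} {G : SimpleGraph V} {S T : Finset V} {a b c u v w : V} {k m n : ℕ}

/-- `G` has an `(a, b)`-path of length at least `n` all of whose vertices lie in `S`. -/
def HasPathIn (G : SimpleGraph V) (S : Finset V) (a b : V) (n : ℕ) : Prop :=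
  ∃ p : G.Walk a b, p.IsPath ∧ (∀ x ∈ p.support, x ∈ S) ∧ n ≤ p.length

/-- Every proper nonempty subset of `S` is left by an edge of `G` inside `S`. -/
def ConnectedOn (G : SimpleGraph V) (S : Finset V) : Prop :=
  ∀ A ⊆ S, ∀ a ∈ A, ∀ b ∈ S, b ∉ A → ∃ x ∈ A, ∃ y ∈ S, y ∉ A ∧ G.Adj x y

namespace HasPathIn

lemma mono (h : HasPathIn G S a b n) (hST : S ⊆ T) (hmn : m ≤ n) : HasPathIn G T a b m := by
  obtain ⟨p, hp, hs, hl⟩ := h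
  exact ⟨p, hp, fun x hx => hST (hs x hx), hmn.trans hl⟩

lemma symm (h : HasPathIn G S a b n) : HasPathIn G S b a n := by
  obtain ⟨p, hp, hs, hl⟩ := h
  exact ⟨p.reverse, hp.reverse, by simpa using hs, by simpa using hl⟩

lemma cons (h : HasPathIn G S a b n) (hu : u ∉ S) (hadj : G.Adj u a) (hST : S ⊆ T)
    (huT : u ∈ T) : HasPathIn G T u b (n + 1) := by
  obtain ⟨p, hp, hs, hl⟩ := h
  refine ⟨p.cons hadj, hp.cons fun hx => hu (hs u hx), fun x hx => ?_, by simpa using hl⟩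
  rw [SimpleGraph.Walk.support_cons, List.mem_cons] at hx
  rcases hx with rfl | hx
  · exact huT
  · exact hST (hs x hx)

lemma one_le_of_ne (h : HasPathIn G S a b n) (hab : a ≠ b) : HasPathIn G S a b 1 := by
  obtain ⟨p, hp, hs, -⟩ := h
  refine ⟨p, hp, hs, ?_⟩
  by_contra hlt
  exact hab (SimpleGraph.Walk.eq_of_length_eq_zero (p := p) (by omega))

variable [DecidableEq V]

lemma append (h : HasPathIn G S a c n) (h' : HasPathIn G T c b m)
    (hST : ∀ x ∈ S, x ∈ T → x = c) : HasPathIn G (S ∪ T) a b (n + m) := by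
  obtain ⟨p, hp, hs, hl⟩ := h
  obtain ⟨q, hq, ht, hl'⟩ := h'
  refine ⟨p.append q, ?_, fun x hx => ?_, by rw [SimpleGraph.Walk.length_append]; omega⟩
  · rw [SimpleGraph.Walk.isPath_def, SimpleGraph.Walk.support_append]
    have hq' := hq.support_nodup
    rw [← SimpleGraph.Walk.cons_tail_support, List.nodup_cons] at hq'
    refine hp.support_nodup.append hq'.2 fun x hx hx' => hq'.1 ?_
    have hxc := hST x (hs x hx) (ht x (List.mem_of_mem_tail hx'))
    exact hxc ▸ hx'
  · rw [SimpleGraph.Walk.mem_support_append_iff] at hx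
    rw [mem_union]
    exact hx.imp (hs x) (ht x)

end HasPathIn

lemma ConnectedOn.of_root (c : V)
    (h : ∀ A ⊆ S, c ∉ A → ∀ a ∈ A, ∃ x ∈ A, ∃ y ∈ S, y ∉ A ∧ G.Adj x y) :
    ConnectedOn G S := by
  classical
  intro A hA a ha b hb hbA
  by_cases hcA : c ∈ A
  · obtain ⟨x, hx, y, hy, hyA, hxy⟩ :=
      h (S \ A) sdiff_subset (by simp [hcA]) b (by simp [hb, hbA])
    exact ⟨y, by grind, x, by grind, by grind, hxy.symm⟩
  · exact h A hA hcA a ha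

lemma ConnectedOn.hasPathIn (h : ConnectedOn G S) (ha : a ∈ S) (hb : b ∈ S) :
    HasPathIn G S a b 0 := by
  classical
  suffices hw : ∃ p : G.Walk a b, ∀ x ∈ p.support, x ∈ S by
    obtain ⟨p, hp⟩ := hw
    exact ⟨p.bypass, p.bypass_isPath,
      fun x hx => hp x (p.support_bypass_subset_support hx), Nat.zero_le _⟩
  by_contra hn
  obtain ⟨x, hx, y, hy, hyA, hxy⟩ :=
    h (S.filter fun y => ∃ p : G.Walk a y, ∀ x ∈ p.support, x ∈ S) (filter_subset _ _) a
      (mem_filter.2 ⟨ha, .nil, by simpa using ha⟩) b hb (fun hb' => hn (mem_filter.1 hb').2)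
  obtain ⟨p, hp⟩ := (mem_filter.1 hx).2
  refine hyA (mem_filter.2 ⟨hy, p.concat hxy, fun z hz => ?_⟩)
  rw [SimpleGraph.Walk.support_concat, List.mem_append, List.mem_singleton] at hz
  rcases hz with hz | rfl
  · exact hp z hz
  · exact hy

section

variable [DecidableEq V]

/-- The subgraph of `G` induced on `S` is 2-connected. -/
def TwoConnectedOn (G : SimpleGraph V) (S : Finset V) : Prop :=
  3 ≤ #S ∧ ∀ x ∈ S, ConnectedOn G (S.erase x)

lemma TwoConnectedOn.connectedOn (h : TwoConnectedOn G S) : ConnectedOn G S := by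
  intro A hA a ha b hb hbA
  obtain ⟨x, hx, hxa, hxb⟩ : ∃ x ∈ S, x ≠ a ∧ x ≠ b := by
    have : #({a, b} : Finset V) < #S := card_le_two.trans_lt h.1
    obtain ⟨x, hx, hx'⟩ := exists_mem_notMem_of_card_lt_card this
    exact ⟨x, hx, by grind, by grind⟩
  obtain ⟨y, hy, z, hz, hzA, hyz⟩ := h.2 x hx (A.erase x) (erase_subset_erase x hA) a
    (by grind) b (by grind) (by grind)
  exact ⟨y, by grind, z, by grind, by grind, hyz⟩

lemma TwoConnectedOn.exists_adj_ne (h : TwoConnectedOn G S) (hu : u ∈ S) (hv : v ∈ S)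
    (huv : u ≠ v) : ∃ a ∈ S, a ≠ u ∧ a ≠ v ∧ G.Adj u a := by
  obtain ⟨b, hb, hb'⟩ : ∃ b ∈ S, b ∉ ({u, v} : Finset V) :=
    exists_mem_notMem_of_card_lt_card (card_le_two.trans_lt h.1)
  obtain ⟨x, hx, y, hy, hyA, hxy⟩ := h.2 v hv {u} (by grind) u (by simp) b (by grind) (by grind)
  rw [mem_singleton] at hx
  subst hx
  exact ⟨y, by grind, by grind, by grind, hxy⟩

lemma TwoConnectedOn.hasPathIn_two (h : TwoConnectedOn G S) (hu : u ∈ S) (hv : v ∈ S)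
    (huv : u ≠ v) : HasPathIn G S u v 2 := by
  obtain ⟨a, ha, hau, hav, hadj⟩ := h.exists_adj_ne hu hv huv
  have hp := (h.2 u hu).hasPathIn (a := a) (b := v) (by grind) (by grind)
  exact (hp.one_le_of_ne hav).cons (notMem_erase u S) hadj (erase_subset _ _) hu

/-- `C` is a nonempty union of components of `G[S] - u - c` not containing `v`. -/
structure CutOff (G : SimpleGraph V) (S : Finset V) (u v c : V) (C : Finset V) : Prop where
  mem : c ∈ S
  ne : c ≠ u
  subset : C ⊆ S
  left_notMem : u ∉ C
  cut_notMem : c ∉ C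
  right_notMem : v ∉ C
  nonempty : C.Nonempty
  closed : ∀ y ∈ C, ∀ z ∈ S, G.Adj y z → z ∈ C ∨ z = c ∨ z = u

lemma CutOff.exists_adj {C : Finset V} (hC : CutOff G S u v c C) (h : TwoConnectedOn G S)
    (hu : u ∈ S) : ∃ a ∈ C, G.Adj u a := by
  obtain ⟨y, hy⟩ := hC.nonempty
  obtain ⟨x, hx, z, hz, hzC, hxz⟩ := h.2 c hC.mem C
    (fun x hx => mem_erase.2 ⟨fun e => hC.cut_notMem (e ▸ hx), hC.subset hx⟩) y hy u
    (mem_erase.2 ⟨hC.ne.symm, hu⟩) hC.left_notMem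
  have hzu : z = u := by
    rw [mem_erase] at hz
    rcases hC.closed x hx z hz.2 hxz with h | h | h
    · exact absurd h hzC
    · exact absurd h hz.1
    · exact h
  exact ⟨x, hx, hzu ▸ hxz.symm⟩

lemma CutOff.hasPathIn {C : Finset V} (hC : CutOff G S u v c C) (h : TwoConnectedOn G S)
    (hu : u ∈ S) (hv : v ∈ S) (huv : u ≠ v) : HasPathIn G (S.erase u \ C) c v 0 := by
  obtain ⟨hcS, hcu, hCS, huC, hcC, hvC, hne, hcl⟩ := hC
  have hcT : c ∈ S.erase u \ C := by grind
  refine (ConnectedOn.of_root c fun A hA hcA a ha => ?_).hasPathIn hcT (by grind)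
  obtain ⟨x, hx, y, hy, hyA, hxy⟩ := h.2 u hu A (hA.trans sdiff_subset) a ha c (by grind) hcA
  refine ⟨x, hx, y, ?_, hyA, hxy⟩
  have hxT := hA hx
  rw [mem_sdiff]
  refine ⟨hy, fun hyC => ?_⟩
  have := hcl y hyC x (by grind) hxy.symm
  grind

lemma CutOff.twoConnectedOn_of_minimal {C : Finset V} (hC : CutOff G S u v c C)
    (hmin : ∀ c' C', CutOff G S u v c' C' → ¬ C' ⊂ C) (hcard : 2 ≤ #C) :
    TwoConnectedOn G (insert c C) := by
  obtain ⟨hcS, hcu, hCS, huC, hcC, hvC, hne, hcl⟩ := hC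
  refine ⟨by rw [card_insert_of_notMem hcC]; omega, fun x hx => ?_⟩
  by_cases hxc : x = c
  · subst hxc
    rw [erase_insert hcC]
    intro A hA a ha b hb hbA
    by_contra! hno
    refine hmin x A ⟨hcS, hcu, hA.trans hCS, fun h => huC (hA h), fun h => hcC (hA h),
      fun h => hvC (hA h), ⟨a, ha⟩, fun y hy z hz hyz => ?_⟩ ⟨hA, fun h => hbA (h hb)⟩
    by_contra! hz'
    rcases hcl y (hA hy) z hz hyz with h | h | h
    · exact hno y hy z h hz'.1 hyz
    · exact hz'.2.1 h
    · exact hz'.2.2 h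
  · have hxC : x ∈ C := by grind
    refine ConnectedOn.of_root c fun A hA hcA a ha => ?_
    by_contra! hno
    have hAC : A ⊆ C := fun y hy => by have := hA hy; grind
    have hxA : x ∉ A := fun h => by simpa using hA h
    refine hmin x A ⟨hCS hxC, fun e => huC (e ▸ hxC), hAC.trans hCS, fun h => huC (hAC h), hxA,
      fun h => hvC (hAC h), ⟨a, ha⟩, fun y hy z hz hyz => ?_⟩ ⟨hAC, fun h => hxA (h hxC)⟩
    by_contra! hz'
    have := hcl y (hAC hy) z hz hyz
    exact hno y hy z (by grind) hz'.1 hyz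

lemma exists_cutOff (h : ¬ TwoConnectedOn G (S.erase u)) (hcard : 3 ≤ #(S.erase u)) :
    ∃ c C, CutOff G S u v c C := by
  have : ∃ c ∈ S.erase u, ¬ ConnectedOn G ((S.erase u).erase c) := by
    by_contra! hall
    exact h ⟨hcard, hall⟩
  obtain ⟨c, hc, hc'⟩ := this
  unfold ConnectedOn at hc'
  push Not at hc'
  obtain ⟨A, hA, a, ha, b, hb, hbA, hno⟩ := hc'
  refine ⟨c, ?_⟩
  have hAu : u ∉ A := fun h => by simpa using hA h
  have hAc : c ∉ A := fun h => by simpa using hA h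
  have hAS : A ⊆ S := fun x hx => by have := hA hx; grind
  by_cases hvA : v ∈ A
  · refine ⟨((S.erase u).erase c) \ A, by grind, by grind, by grind, by grind, by grind, by grind,
      ⟨b, by grind⟩, fun y hy z hz hyz => ?_⟩
    have := hno z
    have := hyz.symm
    grind
  · refine ⟨A, by grind, by grind, by grind, by grind, by grind, by grind,
      ⟨a, by grind⟩, fun y hy z hz hyz => ?_⟩
    have := hno y hy z
    grind

end

open Classical in
/-- The number of neighbours of `x` in `S`. -/
noncomputable def degreeIn (G : SimpleGraph V) (S : Finset V) (x : V) : ℕ :=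
  #(S.filter fun y => G.Adj x y)

lemma degreeIn_le [DecidableEq V] (x : V) (h : ∀ y ∈ S, G.Adj x y → y ∈ T) :
    degreeIn G S x ≤ #(T.erase x) := by
  classical
  refine card_le_card fun y hy => ?_
  rw [mem_filter] at hy
  exact mem_erase.2 ⟨hy.2.ne', h y hy.1 hy.2⟩

lemma degreeIn_le_add_one (x : V) (h : ∀ y ∈ S, G.Adj x y → y ∈ T ∨ y = u) :
    degreeIn G S x ≤ degreeIn G T x + 1 := by
  classical
  refine le_trans (card_le_card (t := insert u (T.filter fun y => G.Adj x y)) fun y hy => ?_)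
    (card_insert_le _ _)
  have := h y
  grind

lemma degreeIn_univ [Fintype V] (x : V) : degreeIn G univ x = gdeg G x := by
  classical
  rw [degreeIn, gdeg, ← Set.ncard_coe_finset]
  congr 1
  ext y
  simp

section

variable [DecidableEq V]

/-- The hypotheses of the Bondy–Jackson theorem for the induced subgraph on `S`, where the
exceptional vertex `w` may coincide with an end of the path. -/
structure BondyJacksonHyp (G : SimpleGraph V) (S : Finset V) (u v w : V) (k : ℕ) : Prop where
  twoConnectedOn : TwoConnectedOn G S
  left_mem : u ∈ S
  right_mem : v ∈ S
  ne : u ≠ v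
  card : 4 ≤ #S ∨ w = u ∨ w = v
  le_degree : ∀ x ∈ S, x ≠ u → x ≠ v → x ≠ w → k ≤ degreeIn G S x

lemma BondyJacksonHyp.symm (h : BondyJacksonHyp G S u v w k) : BondyJacksonHyp G S v u w k where
  twoConnectedOn := h.twoConnectedOn
  left_mem := h.right_mem
  right_mem := h.left_mem
  ne := h.ne.symm
  card := by have := h.card; tauto
  le_degree x hx h1 h2 h3 := h.le_degree x hx h2 h1 h3

lemma BondyJacksonHyp.exists_ne (h : BondyJacksonHyp G S u v w k) :
    ∃ x ∈ S, x ≠ u ∧ x ≠ v ∧ x ≠ w := by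
  have hlt : #({u, v, w} : Finset V) < #S := by
    rcases h.card with h4 | rfl | rfl
    · exact card_le_three.trans_lt h4
    · have : ({w, v, w} : Finset V) = {w, v} := by grind
      rw [this]
      exact card_le_two.trans_lt h.twoConnectedOn.1
    · have : ({u, w, w} : Finset V) = {u, w} := by grind
      rw [this]
      exact card_le_two.trans_lt h.twoConnectedOn.1
  obtain ⟨x, hx, hx'⟩ := exists_mem_notMem_of_card_lt_card hlt
  exact ⟨x, hx, by grind, by grind, by grind⟩

lemma BondyJacksonHyp.lt_card (h : BondyJacksonHyp G S u v w k) : k < #S := by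
  obtain ⟨x, hx, hxu, hxv, hxw⟩ := h.exists_ne
  have h1 := h.le_degree x hx hxu hxv hxw
  have h2 := degreeIn_le (G := G) (S := S) (T := S) x fun y hy _ => hy
  rw [card_erase_of_mem hx] at h2
  have := h.twoConnectedOn.1
  omega

lemma BondyJacksonHyp.hasPathIn_of_le_two (h : BondyJacksonHyp G S u v w k) (hk : k ≤ 2) :
    HasPathIn G S u v k :=
  (h.twoConnectedOn.hasPathIn_two h.left_mem h.right_mem h.ne).mono Subset.rfl hk

lemma BondyJacksonHyp.hasPathIn_of_erase (h : BondyJacksonHyp G S u v w k)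
    (ih : ∀ T ⊂ S, ∀ a b w k, BondyJacksonHyp G T a b w k → HasPathIn G T a b k)
    (h2c : TwoConnectedOn G (S.erase u)) : HasPathIn G S u v k := by
  obtain ⟨a, ha, hau, hav, hadj⟩ := h.twoConnectedOn.exists_adj_ne h.left_mem h.right_mem h.ne
  have haS : a ∈ S.erase u := mem_erase.2 ⟨hau, ha⟩
  have hvS : v ∈ S.erase u := mem_erase.2 ⟨h.ne.symm, h.right_mem⟩
  suffices hp : HasPathIn G (S.erase u) a v (k - 1) from
    (hp.cons (notMem_erase u S) hadj (erase_subset _ _) h.left_mem).mono Subset.rfl (by omega)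
  by_cases hk : k ≤ 3
  · exact (h2c.hasPathIn_two haS hvS hav).mono Subset.rfl (by omega)
  have hlt := h.lt_card
  refine ih _ (erase_ssubset h.left_mem) a v w (k - 1) ⟨h2c, haS, hvS, hav, Or.inl ?_, ?_⟩
  · rw [card_erase_of_mem h.left_mem]
    omega
  · intro x hx hxa hxv hxw
    rw [mem_erase] at hx
    have h1 := h.le_degree x hx.2 hx.1 hxv hxw
    have h2 := degreeIn_le_add_one (G := G) (S := S) (T := S.erase u) (u := u) x
      (by grind)
    omega

lemma BondyJacksonHyp.hasPathIn_of_cutOff (h : BondyJacksonHyp G S u v w k)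
    (ih : ∀ T ⊂ S, ∀ a b w k, BondyJacksonHyp G T a b w k → HasPathIn G T a b k)
    {C : Finset V} (hC : CutOff G S u v c C)
    (hmin : ∀ c' C', CutOff G S u v c' C' → ¬ C' ⊂ C) (hx : ∃ x ∈ C, x ≠ w) :
    HasPathIn G S u v k := by
  by_cases hk : k ≤ 2
  · exact h.hasPathIn_of_le_two hk
  have hdeg : ∀ x ∈ C, x ≠ w → k ≤ degreeIn G (insert c C) x + 1 := fun x hx hxw =>
    (h.le_degree x (hC.subset hx) (fun e => hC.left_notMem (e ▸ hx))
      (fun e => hC.right_notMem (e ▸ hx)) hxw).trans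
      (degreeIn_le_add_one (u := u) x fun y hy hxy => by have := hC.closed x hx y hy hxy; grind)
  have hcardi := card_insert_of_notMem hC.cut_notMem
  have hkC : k ≤ #C + 1 := by
    obtain ⟨x, hx, hxw⟩ := hx
    have h1 := hdeg x hx hxw
    have h2 := degreeIn_le (G := G) (S := insert c C) (T := insert c C) x fun y hy _ => hy
    rw [card_erase_of_mem (mem_insert_of_mem hx)] at h2
    omega
  have h2c := hC.twoConnectedOn_of_minimal hmin (by omega)
  obtain ⟨a, ha, hadj⟩ := hC.exists_adj h.twoConnectedOn h.left_mem
  have hac : a ≠ c := fun e => hC.cut_notMem (e ▸ ha)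
  have huT : u ∉ insert c C := by
    rw [mem_insert, not_or]
    exact ⟨hC.ne.symm, hC.left_notMem⟩
  have hTS : insert c C ⊆ S := insert_subset hC.mem hC.subset
  have hp : HasPathIn G (insert c C) a c (k - 1) := by
    by_cases hk' : k ≤ 3
    · exact (h2c.hasPathIn_two (mem_insert_of_mem ha) (mem_insert_self c C) hac).mono
        Subset.rfl (by omega)
    refine ih _ ⟨hTS, fun hST => huT (hST h.left_mem)⟩ a c w (k - 1)
      ⟨h2c, mem_insert_of_mem ha, mem_insert_self c C, hac, Or.inl (by omega), ?_⟩
    intro x hx hxa hxc hxw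
    have := hdeg x ((mem_insert.1 hx).resolve_left hxc) hxw
    omega
  have hq := hC.hasPathIn h.twoConnectedOn h.left_mem h.right_mem h.ne
  refine ((hp.append hq (by grind)).cons (u := u) (T := S) (by grind) hadj (by grind)
    h.left_mem).mono Subset.rfl (by omega)

lemma BondyJacksonHyp.hasPathIn_or (h : BondyJacksonHyp G S u v w k)
    (ih : ∀ T ⊂ S, ∀ a b w k, BondyJacksonHyp G T a b w k → HasPathIn G T a b k) :
    HasPathIn G S u v k ∨ (G.Adj u w ∧ ¬ G.Adj v w) := by
  by_cases h2c : TwoConnectedOn G (S.erase u)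
  · exact Or.inl (h.hasPathIn_of_erase ih h2c)
  by_cases hk : k ≤ 2
  · exact Or.inl (h.hasPathIn_of_le_two hk)
  have hlt := h.lt_card
  have hex : ∃ c C, CutOff G S u v c C :=
    exists_cutOff h2c (by rw [card_erase_of_mem h.left_mem]; omega)
  by_cases hw : ∃ C, (∃ c, CutOff G S u v c C) ∧ w ∉ C
  · obtain ⟨C₀, hC₀⟩ := hw
    obtain ⟨C, -, hC⟩ := exists_minimal_le_of_wellFoundedLT
      (fun C => (∃ c, CutOff G S u v c C) ∧ w ∉ C) C₀ hC₀
    obtain ⟨⟨c, hc⟩, hwC⟩ := hC.prop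
    refine Or.inl (h.hasPathIn_of_cutOff ih hc (fun c' C' hC' hlt => ?_) ?_)
    · exact hC.not_prop_of_lt hlt ⟨⟨c', hC'⟩, fun hw => hwC (hlt.1 hw)⟩
    · obtain ⟨x, hx⟩ := hc.nonempty
      exact ⟨x, hx, fun e => hwC (e ▸ hx)⟩
  · push Not at hw
    obtain ⟨c₀, C₀, hC₀⟩ := hex
    obtain ⟨C, -, hC⟩ := exists_minimal_le_of_wellFoundedLT
      (fun C => ∃ c, CutOff G S u v c C) C₀ ⟨c₀, hC₀⟩
    obtain ⟨c, hc⟩ := hC.prop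
    by_cases hx : ∃ x ∈ C, x ≠ w
    · exact Or.inl (h.hasPathIn_of_cutOff ih hc
        (fun c' C' hC' hlt => hC.not_prop_of_lt hlt ⟨c', hC'⟩) hx)
    push Not at hx
    have hwC := hw C ⟨c, hc⟩
    right
    constructor
    · obtain ⟨a, ha, hadj⟩ := hc.exists_adj h.twoConnectedOn h.left_mem
      exact hx a ha ▸ hadj
    · intro hvw
      have hcv : v = c := by
        rcases hc.closed w hwC v h.right_mem hvw.symm with h' | h' | h'
        · exact absurd h' hc.right_notMem
        · exact h'
        · exact absurd h'.symm h.ne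
      subst hcv
      obtain ⟨x, hxS, hxu, hxv, hxw⟩ := h.exists_ne
      have hD : CutOff G S u v v (S \ {u, v, w}) := by
        refine ⟨h.right_mem, h.ne.symm, sdiff_subset, by simp, by simp, by simp,
          ⟨x, by simp [hxS, hxu, hxv, hxw]⟩, fun y hy z hz hyz => ?_⟩
        by_cases hzw : z = w
        · have := hc.closed z (hzw ▸ hwC) y (by grind) hyz.symm
          grind
        · grind
      have := hw _ ⟨v, hD⟩
      simp at this

theorem BondyJacksonHyp.hasPathIn (h : BondyJacksonHyp G S u v w k) : HasPathIn G S u v k := by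
  induction S using Finset.strongInduction generalizing u v w k with
  | H S ih =>
    have ih' : ∀ T ⊂ S, ∀ a b w k, BondyJacksonHyp G T a b w k → HasPathIn G T a b k :=
      fun T hT a b w k hB => ih T hT hB
    rcases h.hasPathIn_or ih' with h1 | h1
    · exact h1
    rcases h.symm.hasPathIn_or ih' with h2 | h2
    · exact h2.symm
    exact absurd h1.1 h2.2

lemma TwoConnected.twoConnectedOn_univ [Fintype V] (h : TwoConnected G) :
    TwoConnectedOn G univ := by
  refine ⟨by simpa [Nat.card_eq_fintype_card] using h.1, fun x _ => ?_⟩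
  intro A hA a ha b hb hbA
  have hax : a ≠ x := by simpa using hA ha
  have hbx : b ≠ x := by simpa using hb
  obtain ⟨p⟩ := (h.2 x).preconnected ⟨a, hax⟩ ⟨b, hbx⟩
  obtain ⟨d, -, hd1, hd2⟩ := p.exists_boundary_dart {y | y.1 ∈ A} ha hbA
  exact ⟨d.fst.1, hd1, d.snd.1, mem_erase.2 ⟨d.snd.2, mem_univ _⟩, hd2, d.adj⟩

end

end BondyJackson

/-- Bondy–Jackson (Theorem 2.2): if `G` is 2-connected on at least 4 vertices, `u ≠ v`, and
every vertex other than `u`, `v` and at most one further vertex has degree at least `k`,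
then `G` has a `(u, v)`-path of length at least `k`. -/
theorem stmt_11 {V : Type*} [Fintype V] (G : SimpleGraph V) (k : ℕ)
    (hcard : 4 ≤ Fintype.card V) (h2c : TwoConnected G)
    (u v : V) (huv : u ≠ v)
    (hdeg : ∃ w : V, ∀ x : V, x ≠ u → x ≠ v → x ≠ w → k ≤ gdeg G x) :
    ∃ p : G.Walk u v, p.IsPath ∧ k ≤ p.length := by
  classical
  obtain ⟨w, hw⟩ := hdeg
  have h : BondyJacksonHyp G Finset.univ u v w k :=
    ⟨h2c.twoConnectedOn_univ, Finset.mem_univ u, Finset.mem_univ v, huv,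
      Or.inl (by rwa [Finset.card_univ]),
      fun x _ hxu hxv hxw => by rw [degreeIn_univ]; exact hw x hxu hxv hxw⟩
  obtain ⟨p, hp, -, hl⟩ := h.hasPathIn
  exact ⟨p, hp, hl⟩
end
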